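/- arXiv:2210.04273 — 8 statements merged into one kernel-verified Lean document; each statement's English description precedes it below -/
import Mathlib

section
/- Let n, m ≥ 1. For each i = 1, …, m let ν_i > 0, let u_i be a standard Gaussian random vector with law N(0, I_n) on ℝ^n, let ξ_i be a random element independent of u_i, and let F_i(·, ξ_i) : ℝ^n → ℝ be a jointly measurable random function such that for every x ∈ ℝ^n: E[F_i(x, ξ_i)] = f_i(x), E[F_i(x, ξ_i)²] ≤ σ_{f_i}², F_i(·, ξ_i) is M_i-Lipschitz almost surely, and F_i(·, ξ_i) has an L_i-Lipschitz gradient almost surely. Let f_{i,ν_i}(x) = E[f_i(x + ν_i u_i)] be the Gaussian smoothing of f_i. Then for every x ∈ ℝ^n, E[ Σ_{i=1}^m ( F_i(x + ν_i u_i, ξ_i) − f_{i,ν_i}(x) )² ] ≤ Σ_{i=1}^m ( 4(n+2) M_i² ν_i² + L_i² ν_i⁴ n² ) + 2 Σ_{i=1}^m σ_{f_i}². -/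
open MeasureTheory ProbabilityTheory Real Finset
open scoped RealInnerProductSpace

noncomputable section

/-- `u` is a standard Gaussian random vector with law `N(0, I_n)` on `ℝⁿ`. -/
def IsStdGaussian {Ω : Type*} [MeasurableSpace Ω] (P : Measure Ω) {n : ℕ}
    (u : Ω → EuclideanSpace ℝ (Fin n)) : Prop :=
  Measure.map (fun ω => (fun i => u ω i)) P = Measure.pi fun _ : Fin n => gaussianReal 0 1

/-- Fubini for a function of two independent random elements. -/
theorem integral_comp_of_indepFun {Ω α β : Type*} [MeasurableSpace Ω] [MeasurableSpace α]
    [MeasurableSpace β] {P : Measure Ω} [IsProbabilityMeasure P] {X : Ω → α} {Y : Ω → β}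
    (hX : Measurable X) (hY : Measurable Y) (hXY : IndepFun X Y P) {G : α × β → ℝ}
    (hG : Measurable G) (hint : Integrable (fun ω => G (X ω, Y ω)) P) :
    Integrable (fun ω => ∫ ω', G (X ω, Y ω') ∂P) P ∧
      ∫ ω, G (X ω, Y ω) ∂P = ∫ ω, ∫ ω', G (X ω, Y ω') ∂P ∂P := by
  have := Measure.isProbabilityMeasure_map (μ := P) hX.aemeasurable
  have := Measure.isProbabilityMeasure_map (μ := P) hY.aemeasurable
  have hmap : P.map (fun ω => (X ω, Y ω)) = (P.map X).prod (P.map Y) :=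
    (indepFun_iff_map_prod_eq_prod_map_map hX.aemeasurable hY.aemeasurable).1 hXY
  have hprod : Integrable G ((P.map X).prod (P.map Y)) := by
    rw [← hmap]
    exact (integrable_map_measure hG.aestronglyMeasurable (hX.prodMk hY).aemeasurable).2 hint
  have hinner : ∀ a, ∫ b, G (a, b) ∂(P.map Y) = ∫ ω', G (a, Y ω') ∂P := fun a =>
    integral_map hY.aemeasurable (hG.comp measurable_prodMk_left).aestronglyMeasurable
  have houter := hprod.integral_prod_left
  simp only [hinner] at houter
  refine ⟨houter.comp_measurable hX, ?_⟩
  rw [← integral_map (φ := fun ω => (X ω, Y ω)) (hX.prodMk hY).aemeasurable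
    hG.aestronglyMeasurable, hmap, integral_prod _ hprod]
  simp only [hinner]
  exact integral_map hX.aemeasurable houter.aestronglyMeasurable

/-- The variance of `G (X, Y)`, with `X` and `Y` independent, is at most any uniform bound on the
second moments of the sections `G (a, Y)`. -/
theorem integral_sub_sq_le_of_indepFun {Ω α β : Type*} [MeasurableSpace Ω] [MeasurableSpace α]
    [MeasurableSpace β] {P : Measure Ω} [IsProbabilityMeasure P] {X : Ω → α} {Y : Ω → β}
    (hX : Measurable X) (hY : Measurable Y) (hXY : IndepFun X Y P) {G : α × β → ℝ}
    (hG : Measurable G) {C c : ℝ} (hC : ∀ a, ∫ ω, G (a, Y ω) ^ 2 ∂P ≤ C)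
    (hc : c = ∫ ω, ∫ ω', G (X ω, Y ω') ∂P ∂P)
    (hint : Integrable (fun ω => (G (X ω, Y ω) - c) ^ 2) P) :
    ∫ ω, (G (X ω, Y ω) - c) ^ 2 ∂P ≤ C := by
  have hm : Measurable fun ω => G (X ω, Y ω) := hG.comp (hX.prodMk hY)
  have hsub : MemLp (fun ω => G (X ω, Y ω) - c) 2 P :=
    (memLp_two_iff_integrable_sq (hm.sub_const c).aestronglyMeasurable).2 hint
  have hLp : MemLp (fun ω => G (X ω, Y ω)) 2 P := by
    simpa [Pi.add_def] using hsub.add (memLp_const c)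
  have hmean : c = ∫ ω, G (X ω, Y ω) ∂P :=
    hc.trans (integral_comp_of_indepFun hX hY hXY hG (hLp.integrable one_le_two)).2.symm
  obtain ⟨hsec, hsq⟩ :=
    integral_comp_of_indepFun hX hY hXY (hG.pow_const 2) hLp.integrable_sq
  calc ∫ ω, (G (X ω, Y ω) - c) ^ 2 ∂P
      = variance (fun ω => G (X ω, Y ω)) P := by
        rw [variance_eq_integral hm.aemeasurable, ← hmean]
    _ ≤ ∫ ω, G (X ω, Y ω) ^ 2 ∂P := variance_le_expectation_sq hm.aestronglyMeasurable
    _ = ∫ ω, ∫ ω', G (X ω, Y ω') ^ 2 ∂P ∂P := hsq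
    _ ≤ ∫ _, C ∂P := integral_mono hsec (integrable_const C) fun ω => hC (X ω)
    _ = C := by simp

/-- Lemma on the variance of the noisy constraint evaluations,
vector version: under unbiasedness, bounded second moments, a.s. Lipschitzness and
a.s. Lipschitz gradients of the `F i`, the expectation of
`Σ_i (F_i(x + ν_i u_i, ξ_i) − f_{i,ν_i}(x))²` is bounded by
`Σ_i (4(n+2) M_i² ν_i² + L_i² ν_i⁴ n²) + 2 Σ_i σ_{f_i}²`. -/
theorem statement0
    {n m : ℕ} (hn : 1 ≤ n) (hm : 1 ≤ m)
    {Ω : Type*} [MeasurableSpace Ω] (P : Measure Ω) [IsProbabilityMeasure P]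
    {𝓧 : Fin m → Type*} [∀ i, MeasurableSpace (𝓧 i)]
    (ν M L σf : Fin m → ℝ) (hν : ∀ i, 0 < ν i)
    (u : ∀ _ : Fin m, Ω → EuclideanSpace ℝ (Fin n))
    (hu : ∀ i, IsStdGaussian P (u i)) (humeas : ∀ i, Measurable (u i))
    (ξ : ∀ i : Fin m, Ω → 𝓧 i) (hξmeas : ∀ i, Measurable (ξ i))
    (hindep : ∀ i, IndepFun (u i) (ξ i) P)
    (F : ∀ i : Fin m, EuclideanSpace ℝ (Fin n) → 𝓧 i → ℝ)
    (hFmeas : ∀ i, Measurable (Function.uncurry (F i)))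
    (f : Fin m → EuclideanSpace ℝ (Fin n) → ℝ)
    (hunbiased : ∀ i x, ∫ ω, F i x (ξ i ω) ∂P = f i x)
    (hmoment : ∀ i x, ∫ ω, (F i x (ξ i ω)) ^ 2 ∂P ≤ (σf i) ^ 2)
    (hlip : ∀ i, ∀ᵐ ω ∂P, ∀ x y, |F i x (ξ i ω) - F i y (ξ i ω)| ≤ M i * ‖x - y‖)
    (hgradlip : ∀ i, ∀ᵐ ω ∂P, ∀ x y,
      ‖gradient (fun z => F i z (ξ i ω)) x - gradient (fun z => F i z (ξ i ω)) y‖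
        ≤ L i * ‖x - y‖)
    (fsm : Fin m → EuclideanSpace ℝ (Fin n) → ℝ)
    (hfsm : ∀ i x, fsm i x = ∫ ω, f i (x + ν i • u i ω) ∂P) :
    ∀ x, ∫ ω, ∑ i, (F i (x + ν i • u i ω) (ξ i ω) - fsm i x) ^ 2 ∂P
      ≤ (∑ i, (4 * ((n : ℝ) + 2) * (M i) ^ 2 * (ν i) ^ 2
            + (L i) ^ 2 * (ν i) ^ 4 * (n : ℝ) ^ 2))
        + 2 * ∑ i, (σf i) ^ 2 := by
  intro x
  have hL : 0 ≤ ∑ i, (4 * ((n : ℝ) + 2) * (M i) ^ 2 * (ν i) ^ 2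
      + (L i) ^ 2 * (ν i) ^ 4 * (n : ℝ) ^ 2) := Finset.sum_nonneg fun i _ => by positivity
  have hσ : 0 ≤ ∑ i, (σf i) ^ 2 := Finset.sum_nonneg fun i _ => sq_nonneg _
  by_cases hint : Integrable
      (fun ω => ∑ i, (F i (x + ν i • u i ω) (ξ i ω) - fsm i x) ^ 2) P
  swap
  · rw [integral_undef hint]
    positivity
  have hshift : ∀ i, Measurable fun p : EuclideanSpace ℝ (Fin n) × 𝓧 i =>
      F i (x + ν i • p.1) p.2 := fun i =>
    (hFmeas i).comp (((measurable_fst.const_smul (ν i)).const_add x).prodMk measurable_snd)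
  have hterm : ∀ i, Integrable
      (fun ω => (F i (x + ν i • u i ω) (ξ i ω) - fsm i x) ^ 2) P := fun i => by
    refine hint.mono' ((((hshift i).comp ((humeas i).prodMk (hξmeas i))).sub_const
      (fsm i x)).pow_const 2).aestronglyMeasurable (ae_of_all _ fun ω => ?_)
    rw [Real.norm_of_nonneg (sq_nonneg _)]
    exact Finset.single_le_sum
      (f := fun j => (F j (x + ν j • u j ω) (ξ j ω) - fsm j x) ^ 2)
      (fun j _ => sq_nonneg _) (Finset.mem_univ i)
  have hbound : ∑ i, ∫ ω, (F i (x + ν i • u i ω) (ξ i ω) - fsm i x) ^ 2 ∂P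
      ≤ ∑ i, (σf i) ^ 2 := Finset.sum_le_sum fun i _ =>
    integral_sub_sq_le_of_indepFun (humeas i) (hξmeas i) (hindep i) (hshift i)
      (fun a => hmoment i (x + ν i • a)) (by simp only [hfsm, hunbiased]) (hterm i)
  rw [integral_finsetSum _ fun i _ => hterm i]
  linarith
end
end

section
/- Let f_1, …, f_m : ℝ^n → ℝ be differentiable functions such that each f_i has an L_i-Lipschitz gradient, and let ν_1, …, ν_m > 0. Let f_{i,ν_i}(x) = E[f_i(x + ν_i u)] be the Gaussian smoothing of f_i, where u is a standard Gaussian random vector with law N(0, I_n). Write f(x) = (f_1(x), …, f_m(x)) and f_ν(x) = (f_{1,ν_1}(x), …, f_{m,ν_m}(x)). Then for every x ∈ ℝ^n, ‖ f(x) − f_ν(x) ‖₂ ≤ (n/2) ( Σ_{i=1}^m ν_i⁴ L_i² )^{1/2}. -/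
open MeasureTheory ProbabilityTheory Real Finset
open scoped RealInnerProductSpace

noncomputable section

/-- Second-order Taylor bound for a function with Lipschitz gradient. -/
lemma abs_sub_sub_inner_gradient_le {E : Type*} [NormedAddCommGroup E] [InnerProductSpace ℝ E]
    [CompleteSpace E] {g : E → ℝ} {K : ℝ} (hg : Differentiable ℝ g)
    (hlip : ∀ x y, ‖gradient g x - gradient g y‖ ≤ K * ‖x - y‖) (x h : E) :
    |g (x + h) - g x - ⟪gradient g x, h⟫| ≤ K / 2 * ‖h‖ ^ 2 := by
  have hderiv (t : ℝ) : HasDerivAt (fun t : ℝ => g (x + t • h) - g x - t * ⟪gradient g x, h⟫)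
      (⟪gradient g (x + t • h), h⟫ - ⟪gradient g x, h⟫) t := by
    have hline : HasDerivAt (fun t : ℝ => x + t • h) h t := by
      simpa using ((hasDerivAt_id t).smul_const h).const_add x
    have hcomp := (hg (x + t • h)).hasGradientAt.hasFDerivAt.comp_hasDerivAt t hline
    rw [InnerProductSpace.toDual_apply_apply] at hcomp
    exact ((hcomp.sub_const (g x)).sub
      ((hasDerivAt_id t).mul_const ⟪gradient g x, h⟫)).congr_deriv (by rw [one_mul])
  have hbound (t : ℝ) : HasDerivAt (fun t : ℝ => K / 2 * ‖h‖ ^ 2 * t ^ 2)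
      (K * ‖h‖ ^ 2 * t) t := by
    refine ((hasDerivAt_pow 2 t).const_mul (K / 2 * ‖h‖ ^ 2)).congr_deriv ?_
    norm_num
    ring
  have key := image_norm_le_of_norm_deriv_right_le_deriv_boundary (a := 0) (b := 1)
    (fun t _ => (hderiv t).continuousAt.continuousWithinAt)
    (fun t _ => (hderiv t).hasDerivWithinAt) (by simp) hbound (by
      intro t ht
      rw [← inner_sub_left]
      calc ‖⟪gradient g (x + t • h) - gradient g x, h⟫‖
          ≤ ‖gradient g (x + t • h) - gradient g x‖ * ‖h‖ := norm_inner_le_norm _ _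
        _ ≤ K * ‖x + t • h - x‖ * ‖h‖ := by gcongr; exact hlip _ _
        _ = K * ‖h‖ ^ 2 * t := by
          rw [add_sub_cancel_left, norm_smul, Real.norm_of_nonneg ht.1]
          ring) (Set.right_mem_Icc.2 zero_le_one)
  simpa using key

namespace IsStdGaussian

variable {Ω : Type*} [MeasurableSpace Ω] {P : Measure Ω} {n : ℕ}
  {u : Ω → EuclideanSpace ℝ (Fin n)}

lemma map_apply_eq_gaussianReal (hu : IsStdGaussian P u) (hm : Measurable u) (i : Fin n) :
    Measure.map (fun ω => u ω i) P = gaussianReal 0 1 := by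
  have h := (measurePreserving_eval (fun _ : Fin n => gaussianReal 0 1) i).map_eq
  rw [← hu, Measure.map_map (measurable_pi_apply i) (by fun_prop)] at h
  exact h

lemma hasLaw_apply (hu : IsStdGaussian P u) (hm : Measurable u) (i : Fin n) :
    HasLaw (fun ω => u ω i) (gaussianReal 0 1) P :=
  ⟨by fun_prop, hu.map_apply_eq_gaussianReal hm i⟩

lemma memLp_apply (hu : IsStdGaussian P u) (hm : Measurable u) (i : Fin n) :
    MemLp (fun ω => u ω i) 2 P := by
  have h : MemLp id 2 (gaussianReal 0 1) := memLp_id_gaussianReal 2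
  rw [← hu.map_apply_eq_gaussianReal hm i] at h
  exact h.comp_of_map (by fun_prop)

lemma integral_apply (hu : IsStdGaussian P u) (hm : Measurable u) (i : Fin n) :
    ∫ ω, u ω i ∂P = 0 := by
  rw [(hu.hasLaw_apply hm i).integral_eq, integral_id_gaussianReal]

lemma integral_apply_sq (hu : IsStdGaussian P u) (hm : Measurable u) (i : Fin n) :
    ∫ ω, u ω i ^ 2 ∂P = 1 := by
  have hmeas : Measurable (fun ω => u ω i) := by fun_prop
  rw [← variance_of_integral_eq_zero hmeas.aemeasurable (hu.integral_apply hm i),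
    (hu.hasLaw_apply hm i).variance_eq, variance_id_gaussianReal]
  rfl

lemma integrable_norm_sq (hu : IsStdGaussian P u) (hm : Measurable u) :
    Integrable (fun ω => ‖u ω‖ ^ 2) P := by
  simp_rw [EuclideanSpace.real_norm_sq_eq]
  exact integrable_finsetSum _ fun i _ => (hu.memLp_apply hm i).integrable_sq

lemma integral_norm_sq (hu : IsStdGaussian P u) (hm : Measurable u) :
    ∫ ω, ‖u ω‖ ^ 2 ∂P = n := by
  simp_rw [EuclideanSpace.real_norm_sq_eq]
  rw [integral_finsetSum _ fun i _ => (hu.memLp_apply hm i).integrable_sq]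
  simp [hu.integral_apply_sq hm]

variable [IsProbabilityMeasure P]

lemma integrable_inner (hu : IsStdGaussian P u) (hm : Measurable u)
    (v : EuclideanSpace ℝ (Fin n)) : Integrable (fun ω => ⟪v, u ω⟫) P := by
  simp_rw [PiLp.inner_apply]
  exact integrable_finsetSum _ fun i _ =>
    ((hu.memLp_apply hm i).integrable one_le_two).mul_const (v i)

lemma integral_inner (hu : IsStdGaussian P u) (hm : Measurable u)
    (v : EuclideanSpace ℝ (Fin n)) : ∫ ω, ⟪v, u ω⟫ ∂P = 0 := by
  simp_rw [PiLp.inner_apply, RCLike.inner_apply, conj_trivial]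
  rw [integral_finsetSum _ fun i _ =>
    ((hu.memLp_apply hm i).integrable one_le_two).mul_const (v i)]
  refine Finset.sum_eq_zero fun i _ => ?_
  rw [integral_mul_const, hu.integral_apply hm, zero_mul]

lemma abs_sub_integral_smoothing_le (hu : IsStdGaussian P u) (hm : Measurable u)
    {g : EuclideanSpace ℝ (Fin n) → ℝ} {K : ℝ} (hg : Differentiable ℝ g)
    (hlip : ∀ x y, ‖gradient g x - gradient g y‖ ≤ K * ‖x - y‖) (ν : ℝ)
    (x : EuclideanSpace ℝ (Fin n)) :
    |g x - ∫ ω, g (x + ν • u ω) ∂P| ≤ n / 2 * (ν ^ 2 * K) := by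
  set r : Ω → ℝ := fun ω => g (x + ν • u ω) - g x - ν * ⟪gradient g x, u ω⟫ with hr
  have hbound (ω : Ω) : ‖r ω‖ ≤ K / 2 * ν ^ 2 * ‖u ω‖ ^ 2 := by
    have h := abs_sub_sub_inner_gradient_le hg hlip x (ν • u ω)
    rw [real_inner_smul_right, norm_smul, mul_pow, Real.norm_eq_abs, sq_abs, ← mul_assoc] at h
    exact h
  have hdom : Integrable (fun ω => K / 2 * ν ^ 2 * ‖u ω‖ ^ 2) P :=
    (hu.integrable_norm_sq hm).const_mul _
  have hgm : Measurable g := hg.continuous.measurable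
  have hrm : Measurable r :=
    ((hgm.comp ((hm.const_smul ν).const_add x)).sub_const _).sub
      ((measurable_const.inner hm).const_mul ν)
  have hri : Integrable r P :=
    hdom.mono' hrm.aestronglyMeasurable (Filter.Eventually.of_forall hbound)
  have hlin : Integrable (fun ω => ν * ⟪gradient g x, u ω⟫) P :=
    (hu.integrable_inner hm _).const_mul ν
  have hsplit : ∫ ω, g (x + ν • u ω) ∂P = ∫ ω, r ω ∂P + g x := by
    have heq : (fun ω => g (x + ν • u ω)) =
        fun ω => r ω + (g x + ν * ⟪gradient g x, u ω⟫) := by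
      funext ω
      simp only [hr]
      ring
    have hlin' : Integrable (fun ω => g x + ν * ⟪gradient g x, u ω⟫) P :=
      (integrable_const _).add hlin
    rw [heq, integral_add hri hlin', integral_add (integrable_const _) hlin, integral_const_mul, hu.integral_inner hm]
    simp
  rw [hsplit, sub_add_cancel_right, abs_neg]
  calc |∫ ω, r ω ∂P| ≤ ∫ ω, K / 2 * ν ^ 2 * ‖u ω‖ ^ 2 ∂P :=
        norm_integral_le_of_norm_le hdom (Filter.Eventually.of_forall hbound)
    _ = n / 2 * (ν ^ 2 * K) := by
      rw [integral_const_mul, hu.integral_norm_sq hm]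
      ring

end IsStdGaussian

/-- if each `f_i` has an `L_i`-Lipschitz gradient, then the vector of
Gaussian smoothings satisfies `‖f(x) − f_ν(x)‖₂ ≤ (n/2)(Σ ν_i⁴ L_i²)^{1/2}`. -/
theorem statement6
    {n m : ℕ}
    {Ω : Type*} [MeasurableSpace Ω] (P : Measure Ω) [IsProbabilityMeasure P]
    (f : Fin m → EuclideanSpace ℝ (Fin n) → ℝ) (L : Fin m → ℝ)
    (hdiff : ∀ i, Differentiable ℝ (f i))
    (hgradlip : ∀ i x y, ‖gradient (f i) x - gradient (f i) y‖ ≤ L i * ‖x - y‖)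
    (ν : Fin m → ℝ) (hν : ∀ i, 0 < ν i)
    (u : Ω → EuclideanSpace ℝ (Fin n))
    (hu : IsStdGaussian P u) (humeas : Measurable u)
    (fν : Fin m → EuclideanSpace ℝ (Fin n) → ℝ)
    (hfν : ∀ i x, fν i x = ∫ ω, f i (x + ν i • u ω) ∂P) :
    ∀ x, Real.sqrt (∑ i, (f i x - fν i x) ^ 2)
      ≤ (n : ℝ) / 2 * Real.sqrt (∑ i, (ν i) ^ 4 * (L i) ^ 2) := by
  intro x
  have hn : (0 : ℝ) ≤ n / 2 := by positivity
  refine Real.sqrt_le_iff.2 ⟨by positivity, ?_⟩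
  rw [mul_pow, Real.sq_sqrt (Finset.sum_nonneg fun i _ => by positivity), Finset.mul_sum]
  refine Finset.sum_le_sum fun i _ => ?_
  have h := hu.abs_sub_integral_smoothing_le humeas (hdiff i) (hgradlip i) (ν i) x
  rw [← hfν] at h
  calc (f i x - fν i x) ^ 2 = |f i x - fν i x| ^ 2 := (sq_abs _).symm
    _ ≤ ((n : ℝ) / 2 * (ν i ^ 2 * L i)) ^ 2 := by gcongr
    _ = ((n : ℝ) / 2) ^ 2 * (ν i ^ 4 * L i ^ 2) := by ring
end
end

section
/- Let S ⊆ ℝ^n be a convex set, let ω : ℝ^n → ℝ be differentiable, and define the Bregman divergence W(y, x) = ω(y) − ω(x) − ⟨∇ω(x), y − x⟩. Let μ ≥ 0 and let g : ℝ^n → ℝ be differentiable with g(y) ≥ g(x) + ⟨∇g(x), y − x⟩ + μ W(y, x) for all x, y ∈ S. Let x̃ ∈ ℝ^n and suppose x̄ ∈ S minimizes x ↦ g(x) + W(x, x̃) over S. Then for every x ∈ S, g(x̄) + W(x̄, x̃) + (μ + 1) W(x, x̄) ≤ g(x) + W(x, x̃). -/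
open MeasureTheory ProbabilityTheory Real Finset
open scoped RealInnerProductSpace

noncomputable section

/-- First-order optimality: a differentiable function minimized over a convex set at `a` has
nonnegative slope at `a` towards every other point of the set. -/
theorem inner_gradient_sub_nonneg_of_isMinOn {E : Type*} [NormedAddCommGroup E]
    [InnerProductSpace ℝ E] [CompleteSpace E] {S : Set E} (hS : Convex ℝ S) {f : E → ℝ} {v a x : E}
    (hf : HasGradientAt f v a) (hmin : IsMinOn f S a) (ha : a ∈ S) (hx : x ∈ S) :
    0 ≤ ⟪v, x - a⟫ := by
  simpa using hmin.localize.hasFDerivWithinAt_nonneg hf.hasFDerivAt.hasFDerivWithinAt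
    (sub_mem_posTangentConeAt_of_segment_subset (hS.segment_subset ha hx))

/-- three-point lemma for Bregman divergences: if `g` satisfies
`g(y) ≥ g(x) + ⟨∇g(x), y − x⟩ + μ W(y, x)` on the convex set `S` and
`x̄` minimizes `g(·) + W(·, x̃)` over `S`, then for every `x ∈ S`,
`g(x̄) + W(x̄, x̃) + (μ+1) W(x, x̄) ≤ g(x) + W(x, x̃)`. -/
theorem statement8
    {n : ℕ}
    (S : Set (EuclideanSpace ℝ (Fin n))) (hS : Convex ℝ S)
    (w : EuclideanSpace ℝ (Fin n) → ℝ) (hw : Differentiable ℝ w)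
    (W : EuclideanSpace ℝ (Fin n) → EuclideanSpace ℝ (Fin n) → ℝ)
    (hW : ∀ y x, W y x = w y - w x - ⟪gradient w x, y - x⟫)
    (μ : ℝ) (hμ : 0 ≤ μ)
    (g : EuclideanSpace ℝ (Fin n) → ℝ) (hg : Differentiable ℝ g)
    (hconv : ∀ x ∈ S, ∀ y ∈ S, g y ≥ g x + ⟪gradient g x, y - x⟫ + μ * W y x)
    (xt : EuclideanSpace ℝ (Fin n)) (xbar : EuclideanSpace ℝ (Fin n)) (hxbar : xbar ∈ S)
    (hmin : ∀ x ∈ S, g xbar + W xbar xt ≤ g x + W x xt) :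
    ∀ x ∈ S, g xbar + W xbar xt + (μ + 1) * W x xbar ≤ g x + W x xt := by
  intro x hx
  have hder : HasGradientAt (fun z => g z + W z xt)
      (gradient g xbar + (gradient w xbar - gradient w xt)) xbar := by
    rw [hasGradientAt_iff_hasFDerivAt]
    have hlin : HasFDerivAt (fun z => ⟪gradient w xt, z - xt⟫)
        (InnerProductSpace.toDual ℝ _ (gradient w xt)) xbar :=
      (InnerProductSpace.toDual ℝ _ (gradient w xt)).hasFDerivAt.comp xbar
        ((hasFDerivAt_id xbar).sub_const xt)
    simp only [hW, map_add, map_sub]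
    exact (hg xbar).hasGradientAt.hasFDerivAt.add
      (((hw xbar).hasGradientAt.hasFDerivAt.sub_const (w xt)).sub hlin)
  have hopt := inner_gradient_sub_nonneg_of_isMinOn hS hder (fun z hz => hmin z hz) hxbar hx
  have hsplit : ⟪gradient w xt, x - xt⟫ =
      ⟪gradient w xt, x - xbar⟫ + ⟪gradient w xt, xbar - xt⟫ := by
    rw [← inner_add_right, sub_add_sub_cancel]
  rw [inner_add_left, inner_sub_left] at hopt
  linarith [hconv xbar hxbar x hx, hW x xbar, hW x xt, hW xbar xt]
end
end

section
/- Let S ⊆ ℝ^n be a nonempty convex set, let ρ_0, …, ρ_j ∈ ℝ^n, and let v_0 ∈ S with, for each t = 0, …, j, v_{t+1} ∈ S minimizing x ↦ ⟨ρ_t, x⟩ + (1/2)‖x − v_t‖₂² over S. Then for every x ∈ S, Σ_{t=0}^{j} ⟨ρ_t, v_t − x⟩ ≤ (1/2)‖x − v_0‖₂² + (1/2) Σ_{t=0}^{j} ‖ρ_t‖₂². -/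
open MeasureTheory ProbabilityTheory Real Finset
open scoped RealInnerProductSpace

noncomputable section

/-- First-order optimality condition for a proximal step over a convex set. -/
theorem inner_add_sub_nonneg_of_prox_min {E : Type*} [NormedAddCommGroup E]
    [InnerProductSpace ℝ E] {S : Set E} (hS : Convex ℝ S) {r u w x : E}
    (hw : w ∈ S) (hx : x ∈ S)
    (hmin : ∀ y ∈ S, ⟪r, w⟫ + 1 / 2 * ‖w - u‖ ^ 2 ≤ ⟪r, y⟫ + 1 / 2 * ‖y - u‖ ^ 2) :
    0 ≤ ⟪r + (w - u), x - w⟫ := by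
  by_contra! hc
  set c : ℝ := ⟪r + (w - u), x - w⟫ with hcdef
  set D : ℝ := ‖x - w‖ ^ 2 with hD
  have hD0 : 0 ≤ D := by positivity
  have hpos : 0 < D - c := by linarith
  set s : ℝ := -c / (D - c) with hs
  have hs0 : 0 < s := div_pos (by linarith) hpos
  have hs1 : s ≤ 1 := (div_le_one hpos).2 (by linarith)
  have hsD : s * (D - c) = -c := div_mul_cancel₀ _ hpos.ne'
  have hy := hmin _ (hS.add_smul_sub_mem hw hx ⟨hs0.le, hs1⟩)
  have hnorm : ‖w + s • (x - w) - u‖ ^ 2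
      = ‖w - u‖ ^ 2 + 2 * (s * ⟪w - u, x - w⟫) + s ^ 2 * D := by
    rw [add_sub_right_comm, norm_add_sq_real, inner_smul_right, norm_smul, mul_pow,
      Real.norm_eq_abs, sq_abs]
  rw [hnorm, inner_add_right, inner_smul_right] at hy
  rw [inner_add_left] at hcdef
  have hquad : 0 ≤ s * (c + s * D / 2) := by rw [hcdef]; linarith
  have hlin : 0 ≤ c + s * D / 2 := nonneg_of_mul_nonneg_right hquad hs0
  nlinarith

/-- One-step progress inequality for a proximal step over a convex set. -/
theorem inner_sub_le_of_prox_min {E : Type*} [NormedAddCommGroup E]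
    [InnerProductSpace ℝ E] {S : Set E} (hS : Convex ℝ S) {r u w x : E}
    (hw : w ∈ S) (hx : x ∈ S)
    (hmin : ∀ y ∈ S, ⟪r, w⟫ + 1 / 2 * ‖w - u‖ ^ 2 ≤ ⟪r, y⟫ + 1 / 2 * ‖y - u‖ ^ 2) :
    ⟪r, u - x⟫ ≤ 1 / 2 * ‖x - u‖ ^ 2 - 1 / 2 * ‖x - w‖ ^ 2 + 1 / 2 * ‖r‖ ^ 2 := by
  have hopt := inner_add_sub_nonneg_of_prox_min hS hw hx hmin
  rw [inner_add_left] at hopt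
  have hxu : ‖x - u‖ ^ 2 = ‖w - u‖ ^ 2 + 2 * ⟪w - u, x - w⟫ + ‖x - w‖ ^ 2 := by
    rw [← norm_add_sq_real, add_comm, sub_add_sub_cancel]
  have hru : 0 ≤ ‖r‖ ^ 2 + 2 * ⟪r, w - u⟫ + ‖w - u‖ ^ 2 := by
    rw [← norm_add_sq_real]
    positivity
  have hsplit : ⟪r, u - x⟫ = -⟪r, w - u⟫ - ⟪r, x - w⟫ := by
    simp only [inner_sub_right]
    ring
  linarith

/-- for the proximal sequence `v_{t+1} = argmin_{x ∈ S} ⟨ρ_t, x⟩ +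
(1/2)‖x − v_t‖²`, one has for every `x ∈ S`,
`Σ_{t=0}^{j} ⟨ρ_t, v_t − x⟩ ≤ (1/2)‖x − v_0‖² + (1/2) Σ_{t=0}^{j} ‖ρ_t‖²`. -/
theorem statement10
    {n : ℕ}
    (S : Set (EuclideanSpace ℝ (Fin n))) (hS : Convex ℝ S) (hne : S.Nonempty)
    (j : ℕ) (ρ : ℕ → EuclideanSpace ℝ (Fin n)) (v : ℕ → EuclideanSpace ℝ (Fin n))
    (hv0 : v 0 ∈ S)
    (hmem : ∀ t ≤ j, v (t + 1) ∈ S)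
    (hmin : ∀ t ≤ j, ∀ x ∈ S,
      ⟪ρ t, v (t + 1)⟫ + 1 / 2 * ‖v (t + 1) - v t‖ ^ 2
        ≤ ⟪ρ t, x⟫ + 1 / 2 * ‖x - v t‖ ^ 2) :
    ∀ x ∈ S,
      ∑ t ∈ Finset.range (j + 1), (⟪ρ t, v t - x⟫ : ℝ)
        ≤ 1 / 2 * ‖x - v 0‖ ^ 2 + 1 / 2 * ∑ t ∈ Finset.range (j + 1), ‖ρ t‖ ^ 2 := by
  intro x hx
  have hstep : ∀ t ∈ Finset.range (j + 1), (⟪ρ t, v t - x⟫ : ℝ)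
      ≤ (1 / 2 * ‖x - v t‖ ^ 2 - 1 / 2 * ‖x - v (t + 1)‖ ^ 2) + 1 / 2 * ‖ρ t‖ ^ 2 := by
    intro t ht
    have htj : t ≤ j := Nat.lt_succ_iff.1 (Finset.mem_range.1 ht)
    exact inner_sub_le_of_prox_min hS (hmem t htj) hx (hmin t htj)
  have hsum := Finset.sum_le_sum hstep
  rw [Finset.sum_add_distrib, ← Finset.mul_sum,
    Finset.sum_range_sub' (fun t => 1 / 2 * ‖x - v t‖ ^ 2)] at hsum
  have hlast : 0 ≤ 1 / 2 * ‖x - v (j + 1)‖ ^ 2 := by positivity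
  linarith
end
end

section
/- Let X ⊆ ℝ^n, let f_0 : X → ℝ and f : X → ℝ^m, and define the Lagrangian L(x, y) = f_0(x) + ⟨y, f(x)⟩ for x ∈ X and y ∈ ℝ^m with y ≥ 0. Suppose (x*, y*) with x* ∈ X and y* ≥ 0 is a saddle point, i.e., L(x*, y) ≤ L(x*, y*) ≤ L(x, y*) for all x ∈ X and all y ≥ 0. Let x̄ ∈ X with [f(x̄)]₊ ≠ 0 and set ŷ = (‖y*‖₂ + 1) [f(x̄)]₊ / ‖[f(x̄)]₊‖₂. Then for every ȳ ∈ ℝ^m with ȳ ≥ 0, L(x̄, ŷ) − L(x*, ȳ) ≥ ‖[f(x̄)]₊‖₂. -/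
open MeasureTheory ProbabilityTheory Real Finset
open scoped RealInnerProductSpace

noncomputable section

/-- if `(x*, y*)` is a saddle point of the Lagrangian
`L(x, y) = f_0(x) + ⟨y, f(x)⟩`, `x̄ ∈ X` with `[f(x̄)]₊ ≠ 0`, and
`ŷ = (‖y*‖₂ + 1)[f(x̄)]₊ / ‖[f(x̄)]₊‖₂`, then for every `ȳ ≥ 0`,
`L(x̄, ŷ) − L(x*, ȳ) ≥ ‖[f(x̄)]₊‖₂`. -/
theorem statement15
    {n m : ℕ}
    (X : Set (EuclideanSpace ℝ (Fin n)))
    (f0 : EuclideanSpace ℝ (Fin n) → ℝ) (f : EuclideanSpace ℝ (Fin n) → Fin m → ℝ)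
    (Lag : EuclideanSpace ℝ (Fin n) → (Fin m → ℝ) → ℝ)
    (hLag : ∀ x y, Lag x y = f0 x + ∑ i, y i * f x i)
    (xstar : EuclideanSpace ℝ (Fin n)) (ystar : Fin m → ℝ)
    (hxstar : xstar ∈ X) (hystar : ∀ i, 0 ≤ ystar i)
    (hsaddle : ∀ x ∈ X, ∀ y : Fin m → ℝ, (∀ i, 0 ≤ y i) →
      Lag xstar y ≤ Lag xstar ystar ∧ Lag xstar ystar ≤ Lag x ystar)
    (xb : EuclideanSpace ℝ (Fin n)) (hxb : xb ∈ X)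
    (hpos : (fun i => max (f xb i) 0) ≠ 0)
    (yhat : Fin m → ℝ)
    (hyhat : ∀ i, yhat i = (Real.sqrt (∑ j, (ystar j) ^ 2) + 1) * max (f xb i) 0
      / Real.sqrt (∑ j, (max (f xb j) 0) ^ 2)) :
    ∀ yb : Fin m → ℝ, (∀ i, 0 ≤ yb i) →
      Lag xb yhat - Lag xstar yb ≥ Real.sqrt (∑ i, (max (f xb i) 0) ^ 2) := by
  intro yb hyb
  obtain ⟨h_dual, h_primal⟩ := hsaddle xb hxb yb hyb
  rw [hLag xb ystar] at h_primal
  rw [hLag xb yhat]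
  set N := Real.sqrt (∑ i, (max (f xb i) 0) ^ 2)
  set Y := Real.sqrt (∑ j, (ystar j) ^ 2)
  have hN_sq : N * N = ∑ i, (max (f xb i) 0) ^ 2 :=
    Real.mul_self_sqrt (Finset.sum_nonneg fun i _ => sq_nonneg _)
  have hN_pos : 0 < N := by
    obtain ⟨i, hi⟩ := Function.ne_iff.mp hpos
    exact Real.sqrt_pos.mpr (Finset.sum_pos' (fun j _ => sq_nonneg _)
      ⟨i, Finset.mem_univ i, pow_pos (lt_of_le_of_ne (le_max_right _ _) (Ne.symm hi)) 2⟩)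
  have h_mul_pos : ∀ a : ℝ, max a 0 * a = (max a 0) ^ 2 := fun a => by
    rcases le_total a 0 with h | h
    · simp [max_eq_right h]
    · rw [max_eq_left h, sq]
  have h_hat : ∑ i, yhat i * f xb i = (Y + 1) * N := by
    calc ∑ i, yhat i * f xb i = ∑ i, (Y + 1) / N * (max (f xb i) 0) ^ 2 :=
          Finset.sum_congr rfl fun i _ => by rw [hyhat, ← h_mul_pos]; ring
      _ = (Y + 1) * N := by
          rw [← Finset.mul_sum, ← hN_sq]
          field_simp
  have h_star : ∑ i, ystar i * f xb i ≤ Y * N :=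
    (Finset.sum_le_sum fun i _ => mul_le_mul_of_nonneg_left (le_max_left _ 0) (hystar i)).trans
      (Real.sum_mul_le_sqrt_mul_sqrt _ _ _)
  linarith
end
end

section
/- Let n, m ≥ 1 and D_X ≥ 0. For each i = 1, …, m let ν_i > 0, let u_i be a standard Gaussian random vector with law N(0, I_n) on ℝ^n, let ξ_i be a random element independent of u_i, and let F_i(·, ξ_i) : ℝ^n → ℝ be a jointly measurable random function such that for every x ∈ ℝ^n: E[F_i(x, ξ_i)] = f_i(x), E[F_i(x, ξ_i)²] ≤ σ_{f_i}², F_i(·, ξ_i) is M_i-Lipschitz almost surely, F_i(·, ξ_i) has an L_i-Lipschitz gradient almost surely, E[∇F_i(x, ξ_i)] = ∇f_i(x), and E[‖∇F_i(x, ξ_i) − ∇f_i(x)‖²] ≤ σ_i². Let f_{i,ν_i} be the Gaussian smoothing of f_i, let G_{i,ν_i}(x, ξ_i, u_i) = ((F_i(x + ν_i u_i, ξ_i) − F_i(x, ξ_i))/ν_i) · u_i, and define σ_{f,ν}² = Σ_{i=1}^m (4(n+2) M_i² ν_i² + L_i² ν_i⁴ n²) + 2 Σ_{i=1}^m σ_{f_i}²,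 B̃_i = (ν_i/2) L_i (n+3)^{3/2} + L_i D_X + M_i, and σ_{i,ν_i}² = ν_i² L_i² (n+6)³ + 10(n+4)(σ_i² + B̃_i²). Then for every x ∈ ℝ^n and every d ∈ ℝ^n with ‖d‖ ≤ D_X, E[ Σ_{i=1}^m ( F_i(x + ν_i u_i, ξ_i) − f_{i,ν_i}(x) + ⟨ G_{i,ν_i}(x, ξ_i, u_i) − ∇f_{i,ν_i}(x), d ⟩ )² ] ≤ 2 σ_{f,ν}² + 2 D_X² Σ_{i=1}^m σ_{i,ν_i}². -/
open MeasureTheory ProbabilityTheory Real Finset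
open scoped RealInnerProductSpace

noncomputable section

/-- The fourth moment of a centered real Gaussian with variance `v` is `3 v ^ 2`. -/
lemma integral_pow_four_gaussianReal (v : NNReal) :
    ∫ x, x ^ 4 ∂(gaussianReal 0 v) = 3 * (v : ℝ) ^ 2 := by
  have h := iteratedDeriv_mgf_zero (X := id) (μ := gaussianReal 0 v) (by simp) 4
  have hstep : ∀ p p' : ℝ → ℝ, (∀ t, HasDerivAt p (p' t) t) →
      deriv (fun t => p t * rexp (v * t ^ 2 / 2)) =
        fun t => (p' t + v * t * p t) * rexp (v * t ^ 2 / 2) := by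
    intro p p' hp
    funext t
    have he : HasDerivAt (fun t : ℝ => rexp (v * t ^ 2 / 2))
        (rexp (v * t ^ 2 / 2) * (v * t)) t := by
      apply HasDerivAt.exp
      convert! (((hasDerivAt_id t).pow 2).const_mul (v : ℝ)).div_const 2 using 1
      simp
      ring
    refine ((hp t).mul he).deriv.trans ?_
    ring
  have hmgf : mgf id (gaussianReal 0 v) = fun t => (fun _ => (1 : ℝ)) t * rexp (v * t ^ 2 / 2) := by
    rw [mgf_id_gaussianReal]; simp
  have hpoly : ∀ (a b c e t : ℝ), HasDerivAt (fun t => a + b * t + c * t ^ 2 + e * t ^ 3)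
      (b + 2 * c * t + 3 * e * t ^ 2) t := by
    intro a b c e t
    have h1 := ((hasDerivAt_id t).const_mul b)
    have h2 := (((hasDerivAt_id t).pow 2).const_mul c)
    have h3 := (((hasDerivAt_id t).pow 3).const_mul e)
    convert! ((h1.const_add a).add h2).add h3 using 1
    simp
    ring
  have h' : iteratedDeriv 4 (mgf id (gaussianReal 0 v)) 0 = 3 * (v : ℝ) ^ 2 := by
    rw [hmgf]
    simp only [iteratedDeriv_succ, iteratedDeriv_zero]
    rw [hstep _ (fun _ => 0) (fun t => hasDerivAt_const t 1)]
    rw [hstep (fun t => 0 + v * t * 1) (fun t => v) (fun t => by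
      convert! hpoly 0 v 0 0 t using 1 <;> [(funext t; ring); ring])]
    rw [hstep (fun t => v + v * t * (0 + v * t * 1)) (fun t => 2 * v ^ 2 * t) (fun t => by
      convert! hpoly v 0 (v ^ 2) 0 t using 1 <;> [(funext t; ring); ring])]
    rw [hstep (fun t => 2 * v ^ 2 * t + v * t * (v + v * t * (0 + v * t * 1)))
      (fun t => 3 * v ^ 2 + 3 * v ^ 3 * t ^ 2) (fun t => by
      convert! hpoly 0 (3 * v ^ 2) 0 (v ^ 3) t using 1 <;> [(funext t; ring); ring])]
    simp
  rw [h'] at h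
  simpa using h.symm

lemma IsStdGaussian.map_eq_stdGaussian {Ω : Type*} [MeasurableSpace Ω] {P : Measure Ω} {n : ℕ}
    {u : Ω → EuclideanSpace ℝ (Fin n)} (hu : IsStdGaussian P u) (hm : Measurable u) :
    P.map u = stdGaussian (EuclideanSpace ℝ (Fin n)) := by
  rw [← map_pi_eq_stdGaussian, ← hu, Measure.map_map (by fun_prop) (by fun_prop)]
  rfl

section StdGaussian

variable {E : Type*} [NormedAddCommGroup E] [InnerProductSpace ℝ E] [FiniteDimensional ℝ E]
  [MeasurableSpace E] [BorelSpace E]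

lemma map_inner_stdGaussian (d : E) :
    (stdGaussian E).map (fun x => ⟪d, x⟫) = gaussianReal 0 (‖d‖ ^ 2).toNNReal := by
  have h := IsGaussian.map_eq_gaussianReal (μ := stdGaussian E) (innerSL ℝ d)
  rw [integral_strongDual_stdGaussian, variance_dual_stdGaussian, innerSL_apply_norm] at h
  exact h

lemma integral_inner_pow_four_stdGaussian (d : E) :
    ∫ x, ⟪d, x⟫ ^ 4 ∂(stdGaussian E) = 3 * ‖d‖ ^ 4 := by
  rw [← integral_map (φ := fun x => ⟪d, x⟫) (f := fun y => y ^ 4) (by fun_prop) (by fun_prop),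
    map_inner_stdGaussian, integral_pow_four_gaussianReal, Real.coe_toNNReal _ (by positivity)]
  ring

lemma integrable_norm_pow_stdGaussian (k : ℕ) :
    Integrable (fun x : E => ‖x‖ ^ k) (stdGaussian E) := by
  exact_mod_cast (IsGaussian.memLp_id (stdGaussian E) k (by simp)).integrable_norm_pow'

lemma integrable_inner_pow_four_stdGaussian (d : E) :
    Integrable (fun x => ⟪d, x⟫ ^ 4) (stdGaussian E) := by
  refine ((integrable_norm_pow_stdGaussian 4).const_mul (‖d‖ ^ 4)).mono' (by fun_prop) ?_
  refine .of_forall fun x => ?_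
  rw [norm_pow, ← mul_pow]
  gcongr
  exact norm_inner_le_norm d x

lemma integrable_norm_sq_mul_inner_sq_stdGaussian (d : E) :
    Integrable (fun x => ‖x‖ ^ 2 * ⟪d, x⟫ ^ 2) (stdGaussian E) := by
  refine ((integrable_norm_pow_stdGaussian 4).const_mul (‖d‖ ^ 2)).mono' (by fun_prop) ?_
  refine .of_forall fun x => ?_
  rw [norm_mul, norm_pow, norm_pow, norm_norm]
  calc _ ≤ ‖x‖ ^ 2 * (‖d‖ * ‖x‖) ^ 2 := by gcongr; exact norm_inner_le_norm d x
    _ = _ := by ring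

lemma integral_norm_sq_mul_inner_sq_stdGaussian_le (d : E) :
    ∫ x, ‖x‖ ^ 2 * ⟪d, x⟫ ^ 2 ∂(stdGaussian E) ≤ 3 * Module.finrank ℝ E * ‖d‖ ^ 2 := by
  have hbound : ∀ x : E, ‖x‖ ^ 2 * ⟪d, x⟫ ^ 2 ≤
      ∑ i, (‖d‖ ^ 2 * ⟪stdOrthonormalBasis ℝ E i, x⟫ ^ 4 + ⟪d, x⟫ ^ 4 * (‖d‖ ^ 2)⁻¹) / 2 := by
    intro x
    rw [← (stdOrthonormalBasis ℝ E).sum_sq_inner_right x, Finset.sum_mul]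
    refine Finset.sum_le_sum fun i _ => ?_
    rcases eq_or_ne d 0 with rfl | hd
    · simp
    have hd' : 0 < ‖d‖ := norm_pos_iff.2 hd
    generalize ⟪stdOrthonormalBasis ℝ E i, x⟫ = p
    generalize ⟪d, x⟫ = q
    have h := sq_nonneg (‖d‖ * p ^ 2 - q ^ 2 / ‖d‖)
    have he : (‖d‖ * p ^ 2 - q ^ 2 / ‖d‖) ^ 2 =
        ‖d‖ ^ 2 * p ^ 4 + q ^ 4 * (‖d‖ ^ 2)⁻¹ - 2 * (p ^ 2 * q ^ 2) := by
      field_simp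
      ring
    linarith
  have hint : ∀ i, Integrable (fun x => (‖d‖ ^ 2 * ⟪stdOrthonormalBasis ℝ E i, x⟫ ^ 4
      + ⟪d, x⟫ ^ 4 * (‖d‖ ^ 2)⁻¹) / 2) (stdGaussian E) := fun i =>
    (((integrable_inner_pow_four_stdGaussian _).const_mul _).add
      ((integrable_inner_pow_four_stdGaussian _).mul_const _)).div_const _
  refine (integral_mono (integrable_norm_sq_mul_inner_sq_stdGaussian d)
    (integrable_finsetSum _ fun i _ => hint i) hbound).trans_eq ?_
  rw [integral_finsetSum _ fun i _ => hint i]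
  have hterm : ∀ i, ∫ x, (‖d‖ ^ 2 * ⟪stdOrthonormalBasis ℝ E i, x⟫ ^ 4
      + ⟪d, x⟫ ^ 4 * (‖d‖ ^ 2)⁻¹) / 2 ∂(stdGaussian E) = 3 * ‖d‖ ^ 2 := by
    intro i
    rw [integral_div, integral_add ((integrable_inner_pow_four_stdGaussian _).const_mul _)
      ((integrable_inner_pow_four_stdGaussian _).mul_const _), integral_const_mul,
      integral_mul_const, integral_inner_pow_four_stdGaussian, integral_inner_pow_four_stdGaussian,
      (stdOrthonormalBasis ℝ E).norm_eq_one]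
    rcases eq_or_ne d 0 with rfl | hd
    · simp
    have hd' : 0 < ‖d‖ := norm_pos_iff.2 hd
    field_simp
    ring
  simp [hterm]
  ring

end StdGaussian

lemma ProbabilityTheory.IndepFun.integral_comp_prodMk {Ω E 𝓧 : Type*} [MeasurableSpace Ω]
    [MeasurableSpace E] [MeasurableSpace 𝓧] {P : Measure Ω} [IsProbabilityMeasure P]
    {u : Ω → E} {ξ : Ω → 𝓧} (h : IndepFun u ξ P) (hu : Measurable u) (hξ : Measurable ξ)
    {H : E × 𝓧 → ℝ} (hH : Measurable H) (hint : Integrable (fun ω => H (u ω, ξ ω)) P) :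
    Integrable (fun ω => ∫ ω', H (u ω, ξ ω') ∂P) P ∧
      ∫ ω, H (u ω, ξ ω) ∂P = ∫ ω, ∫ ω', H (u ω, ξ ω') ∂P ∂P := by
  have hmap := h.map_prod_eq_prod_map_map hu.aemeasurable hξ.aemeasurable
  have := Measure.isProbabilityMeasure_map (μ := P) hu.aemeasurable
  have := Measure.isProbabilityMeasure_map (μ := P) hξ.aemeasurable
  have hint' : Integrable H ((P.map u).prod (P.map ξ)) := by
    rw [← hmap]
    exact (integrable_map_measure hH.aestronglyMeasurable (by fun_prop)).2 hint
  have hin : ∀ y, ∫ z, H (y, z) ∂(P.map ξ) = ∫ ω', H (y, ξ ω') ∂P := fun y =>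
    integral_map hξ.aemeasurable (hH.comp measurable_prodMk_left).aestronglyMeasurable
  have hl := hint'.integral_prod_left
  constructor
  · have := hl.comp_measurable hu
    simpa only [Function.comp_def, hin] using this
  · calc ∫ ω, H (u ω, ξ ω) ∂P = ∫ z, H z ∂(P.map fun ω => (u ω, ξ ω)) :=
          (integral_map (by fun_prop) (by fun_prop)).symm
      _ = ∫ y, ∫ z, H (y, z) ∂(P.map ξ) ∂(P.map u) := by rw [hmap, integral_prod _ hint']
      _ = ∫ ω, ∫ z, H (u ω, z) ∂(P.map ξ) ∂P :=
          integral_map hu.aemeasurable hl.aestronglyMeasurable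
      _ = _ := by simp_rw [hin]

lemma norm_gradient_le_of_lipschitz {E : Type*} [NormedAddCommGroup E] [InnerProductSpace ℝ E]
    [CompleteSpace E] {g : E → ℝ} {M : ℝ} (hM : 0 ≤ M) (hg : ∀ x y, |g x - g y| ≤ M * ‖x - y‖)
    (x : E) : ‖gradient g x‖ ≤ M := by
  rw [gradient, LinearIsometryEquiv.norm_map]
  refine norm_fderiv_le_of_lipschitz (C := ⟨M, hM⟩) ℝ (.of_dist_le_mul fun x y => ?_)
  rw [Real.dist_eq, dist_eq_norm]
  exact hg x y

lemma IsStdGaussian.integrable_norm_pow {Ω : Type*} [MeasurableSpace Ω] {P : Measure Ω} {n : ℕ}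
    {u : Ω → EuclideanSpace ℝ (Fin n)} (hu : IsStdGaussian P u) (hum : Measurable u) (k : ℕ) :
    Integrable (fun ω => ‖u ω‖ ^ k) P := by
  have h := integrable_norm_pow_stdGaussian (E := EuclideanSpace ℝ (Fin n)) k
  rw [← hu.map_eq_stdGaussian hum] at h
  exact h.comp_measurable hum

lemma abs_integral_sub_integral_le {Ω E : Type*} [MeasurableSpace Ω] [NormedAddCommGroup E]
    {P : Measure Ω} [IsProbabilityMeasure P] {Φ : E → Ω → ℝ} {M : ℝ}
    (hlip : ∀ᵐ ω ∂P, ∀ x y, |Φ x ω - Φ y ω| ≤ M * ‖x - y‖)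
    (hint : ∀ y, Integrable (Φ y) P) (y z : E) :
    |∫ ω, Φ y ω ∂P - ∫ ω, Φ z ω ∂P| ≤ M * ‖y - z‖ := by
  rw [← integral_sub (hint y) (hint z), ← Real.norm_eq_abs]
  refine (norm_integral_le_of_norm_le_const (C := M * ‖y - z‖) ?_).trans (by simp)
  filter_upwards [hlip] with ω hω using hω y z

section Smoothing

variable {n : ℕ} {Ω 𝓧 : Type*} [MeasurableSpace Ω] [MeasurableSpace 𝓧] {P : Measure Ω}
  [IsProbabilityMeasure P] {u : Ω → EuclideanSpace ℝ (Fin n)} {ξ : Ω → 𝓧}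
  {F : EuclideanSpace ℝ (Fin n) → 𝓧 → ℝ} {ν M s : ℝ} {x : EuclideanSpace ℝ (Fin n)}

/-- A Lipschitz random function that is square integrable at a randomly perturbed point is square
integrable at every point. -/
lemma memLp_two_of_memLp_two_perturbed (hu : IsStdGaussian P u) (hum : Measurable u)
    (hξ : Measurable ξ) (hF : Measurable (Function.uncurry F))
    (hlip : ∀ᵐ ω ∂P, ∀ x y, |F x (ξ ω) - F y (ξ ω)| ≤ M * ‖x - y‖)
    (hY : MemLp (fun ω => F (x + ν • u ω) (ξ ω)) 2 P) (y : EuclideanSpace ℝ (Fin n)) :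
    MemLp (fun ω => F y (ξ ω)) 2 P := by
  have hnorm : MemLp (fun ω => ‖u ω‖) 2 P :=
    (memLp_two_iff_integrable_sq (by fun_prop)).2 (hu.integrable_norm_pow hum 2)
  have hg : MemLp (fun ω => |M| * (‖y - x‖ + |ν| * ‖u ω‖)) 2 P :=
    ((memLp_const ‖y - x‖).add (hnorm.const_mul |ν|)).const_mul |M|
  have hdiff : MemLp (fun ω => F y (ξ ω) - F (x + ν • u ω) (ξ ω)) 2 P := by
    refine hg.mono' ?_ ?_
    · have h1 : Measurable fun ω => F y (ξ ω) := hF.comp (measurable_const.prodMk hξ)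
      have h2 : Measurable fun ω => F (x + ν • u ω) (ξ ω) :=
        hF.comp (Measurable.prodMk (by fun_prop) hξ)
      exact (h1.sub h2).aestronglyMeasurable
    · filter_upwards [hlip] with ω hω
      refine (hω _ _).trans ?_
      calc M * ‖y - (x + ν • u ω)‖ ≤ |M| * ‖(y - x) - ν • u ω‖ := by
            rw [sub_sub]; gcongr; exact le_abs_self M
        _ ≤ |M| * (‖y - x‖ + |ν| * ‖u ω‖) := by
            gcongr
            refine (norm_sub_le _ _).trans ?_
            rw [norm_smul, Real.norm_eq_abs]
  exact (hdiff.add hY).ae_eq (.of_forall fun ω => by simp)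

lemma abs_smoothing_sub_smoothing_le {f : EuclideanSpace ℝ (Fin n) → ℝ} (hM : 0 ≤ M)
    (hu : IsStdGaussian P u) (hum : Measurable u)
    (hf : ∀ y z, |f y - f z| ≤ M * ‖y - z‖) (y z : EuclideanSpace ℝ (Fin n)) :
    |∫ ω, f (y + ν • u ω) ∂P - ∫ ω, f (z + ν • u ω) ∂P| ≤ M * ‖y - z‖ := by
  have hcont : Continuous f := (LipschitzWith.of_dist_le_mul (K := ⟨M, hM⟩) fun y z => by
    rw [Real.dist_eq, dist_eq_norm]; exact hf y z).continuous
  have hint : ∀ y, Integrable (fun ω => f (y + ν • u ω)) P := by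
    intro y
    have hu1 : Integrable (fun ω => ‖u ω‖) P := by simpa using hu.integrable_norm_pow hum 1
    refine ((integrable_const |f y|).add (hu1.const_mul (M * |ν|))).mono'
      (hcont.measurable.comp (by fun_prop)).aestronglyMeasurable (.of_forall fun ω => ?_)
    have h := hf (y + ν • u ω) y
    rw [add_sub_cancel_left, norm_smul, Real.norm_eq_abs] at h
    have h' := abs_sub_abs_le_abs_sub (f (y + ν • u ω)) (f y)
    simp only [Pi.add_apply, Real.norm_eq_abs]
    linarith
  exact abs_integral_sub_integral_le (.of_forall fun ω y z => by
    simpa using hf (y + ν • u ω) (z + ν • u ω)) hint y z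

/-- The function-value noise of the smoothed oracle is bounded by the second moment of the
oracle. -/
lemma integral_sq_value_noise_le (hum : Measurable u) (hξ : Measurable ξ)
    (hindep : IndepFun u ξ P) (hF : Measurable (Function.uncurry F))
    (hmoment : ∀ y, ∫ ω, F y (ξ ω) ^ 2 ∂P ≤ s)
    (hY : MemLp (fun ω => F (x + ν • u ω) (ξ ω)) 2 P) :
    ∫ ω, (F (x + ν • u ω) (ξ ω) - ∫ ω', ∫ ω'', F (x + ν • u ω') (ξ ω'') ∂P ∂P) ^ 2 ∂P ≤ s := by
  have hH : Measurable fun p : EuclideanSpace ℝ (Fin n) × 𝓧 => F (x + ν • p.1) p.2 :=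
    hF.comp (Measurable.prodMk (by fun_prop) measurable_snd)
  obtain ⟨-, h1⟩ := hindep.integral_comp_prodMk hum hξ hH (hY.integrable (by norm_num))
  obtain ⟨h2, h3⟩ := hindep.integral_comp_prodMk hum hξ (hH.pow_const 2) hY.integrable_sq
  have hvar := variance_le_expectation_sq hY.aestronglyMeasurable
  rw [variance_eq_integral hY.aestronglyMeasurable.aemeasurable] at hvar
  simp only [Pi.pow_apply] at hvar
  rw [← h1]
  refine hvar.trans ?_
  rw [h3]
  exact (integral_mono h2 (integrable_const s) fun ω => hmoment (x + ν • u ω)).trans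
    (by simp)

/-- Second moment of the linearized noise of the two-point gradient estimator around an arbitrary
vector `g`. -/
lemma integral_sq_inner_estimator_sub_le {d g : EuclideanSpace ℝ (Fin n)}
    (hν : 0 < ν) (hM : 0 ≤ M) (hu : IsStdGaussian P u) (hum : Measurable u) (hξ : Measurable ξ)
    (hF : Measurable (Function.uncurry F))
    (hlip : ∀ᵐ ω ∂P, ∀ x y, |F x (ξ ω) - F y (ξ ω)| ≤ M * ‖x - y‖) (hg : ‖g‖ ≤ M) :
    MemLp (fun ω => ⟪((F (x + ν • u ω) (ξ ω) - F x (ξ ω)) / ν) • u ω - g, d⟫) 2 P ∧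
    ∫ ω, ⟪((F (x + ν • u ω) (ξ ω) - F x (ξ ω)) / ν) • u ω - g, d⟫ ^ 2 ∂P
      ≤ (6 * n + 2) * M ^ 2 * ‖d‖ ^ 2 := by
  have hmeas : Measurable
      fun ω => ⟪((F (x + ν • u ω) (ξ ω) - F x (ξ ω)) / ν) • u ω - g, d⟫ := by
    have h1 : Measurable fun ω => F x (ξ ω) := hF.comp (measurable_const.prodMk hξ)
    have h2 : Measurable fun ω => F (x + ν • u ω) (ξ ω) :=
      hF.comp (Measurable.prodMk (by fun_prop) hξ)
    fun_prop
  have hbase := integrable_norm_sq_mul_inner_sq_stdGaussian d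
  have hle := integral_norm_sq_mul_inner_sq_stdGaussian_le d
  rw [← hu.map_eq_stdGaussian hum] at hbase hle
  rw [integral_map hum.aemeasurable (by fun_prop)] at hle
  have hbase' : Integrable (fun ω => ‖u ω‖ ^ 2 * ⟪d, u ω⟫ ^ 2) P := hbase.comp_measurable hum
  have hdom : Integrable (fun ω => 2 * M ^ 2 * (‖u ω‖ ^ 2 * ⟪d, u ω⟫ ^ 2)
      + 2 * M ^ 2 * ‖d‖ ^ 2) P := (hbase'.const_mul _).add (integrable_const _)
  have hpt : ∀ᵐ ω ∂P, ⟪((F (x + ν • u ω) (ξ ω) - F x (ξ ω)) / ν) • u ω - g, d⟫ ^ 2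
      ≤ 2 * M ^ 2 * (‖u ω‖ ^ 2 * ⟪d, u ω⟫ ^ 2) + 2 * M ^ 2 * ‖d‖ ^ 2 := by
    filter_upwards [hlip] with ω hω
    have hq : ((F (x + ν • u ω) (ξ ω) - F x (ξ ω)) / ν) ^ 2 ≤ (M * ‖u ω‖) ^ 2 := by
      rw [sq_le_sq, abs_div, abs_of_pos hν, abs_of_nonneg (by positivity : 0 ≤ M * ‖u ω‖),
        div_le_iff₀ hν]
      refine (hω _ _).trans_eq ?_
      rw [add_sub_cancel_left, norm_smul, Real.norm_eq_abs, abs_of_pos hν]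
      ring
    have hgd : ⟪g, d⟫ ^ 2 ≤ (M * ‖d‖) ^ 2 := by
      rw [sq_le_sq, abs_of_nonneg (by positivity : 0 ≤ M * ‖d‖)]
      exact (abs_real_inner_le_norm g d).trans (by gcongr)
    rw [inner_sub_left, real_inner_smul_left, real_inner_comm d (u ω)]
    generalize (F (x + ν • u ω) (ξ ω) - F x (ξ ω)) / ν = q at hq ⊢
    have h1 := mul_le_mul_of_nonneg_right hq (sq_nonneg ⟪d, u ω⟫)
    have h2 := sq_nonneg (q * ⟪d, u ω⟫ + ⟪g, d⟫)
    nlinarith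
  have hsq : Integrable
      (fun ω => ⟪((F (x + ν • u ω) (ξ ω) - F x (ξ ω)) / ν) • u ω - g, d⟫ ^ 2) P := by
    refine hdom.mono' (by fun_prop) ?_
    filter_upwards [hpt] with ω hω
    rwa [Real.norm_eq_abs, abs_of_nonneg (sq_nonneg _)]
  refine ⟨(memLp_two_iff_integrable_sq hmeas.aestronglyMeasurable).2 hsq, ?_⟩
  refine (integral_mono_ae hsq hdom hpt).trans ?_
  rw [integral_add (hbase'.const_mul _) (integrable_const _), integral_const_mul]
  simp only [finrank_euclideanSpace, Fintype.card_fin] at hle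
  have h := mul_le_mul_of_nonneg_left hle (by positivity : 0 ≤ 2 * M ^ 2)
  simp only [integral_const, probReal_univ, smul_eq_mul, one_mul]
  linarith

end Smoothing

/-- bound on the second moment of the constraint-linearization noise:
for any `d` with `‖d‖ ≤ D_X`,
`E[Σ_i (F_i(x + ν_i u_i, ξ_i) − f_{i,ν_i}(x) + ⟨G_{i,ν_i}(x,ξ_i,u_i) − ∇f_{i,ν_i}(x), d⟩)²]
≤ 2 σ_{f,ν}² + 2 D_X² Σ_i σ_{i,ν_i}²`. -/
theorem statement16
    {n m : ℕ} (hn : 1 ≤ n) (hm : 1 ≤ m) (D_X : ℝ) (hD : 0 ≤ D_X)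
    {Ω : Type*} [MeasurableSpace Ω] (P : Measure Ω) [IsProbabilityMeasure P]
    {𝓧 : Fin m → Type*} [∀ i, MeasurableSpace (𝓧 i)]
    (ν M L σf σ : Fin m → ℝ) (hν : ∀ i, 0 < ν i)
    (u : ∀ _ : Fin m, Ω → EuclideanSpace ℝ (Fin n))
    (hu : ∀ i, IsStdGaussian P (u i)) (humeas : ∀ i, Measurable (u i))
    (ξ : ∀ i : Fin m, Ω → 𝓧 i) (hξmeas : ∀ i, Measurable (ξ i))
    (hindep : ∀ i, IndepFun (u i) (ξ i) P)
    (F : ∀ i : Fin m, EuclideanSpace ℝ (Fin n) → 𝓧 i → ℝ)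
    (hFmeas : ∀ i, Measurable (Function.uncurry (F i)))
    (f : Fin m → EuclideanSpace ℝ (Fin n) → ℝ)
    (hunbiased : ∀ i x, ∫ ω, F i x (ξ i ω) ∂P = f i x)
    (hmoment : ∀ i x, ∫ ω, (F i x (ξ i ω)) ^ 2 ∂P ≤ (σf i) ^ 2)
    (hlip : ∀ i, ∀ᵐ ω ∂P, ∀ x y, |F i x (ξ i ω) - F i y (ξ i ω)| ≤ M i * ‖x - y‖)
    (hgradlip : ∀ i, ∀ᵐ ω ∂P, ∀ x y,
      ‖gradient (fun z => F i z (ξ i ω)) x - gradient (fun z => F i z (ξ i ω)) y‖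
        ≤ L i * ‖x - y‖)
    (hgradunbiased : ∀ i x,
      ∫ ω, gradient (fun z => F i z (ξ i ω)) x ∂P = gradient (f i) x)
    (hgradvar : ∀ i x,
      ∫ ω, ‖gradient (fun z => F i z (ξ i ω)) x - gradient (f i) x‖ ^ 2 ∂P ≤ (σ i) ^ 2)
    (fsm : Fin m → EuclideanSpace ℝ (Fin n) → ℝ)
    (hfsm : ∀ i x, fsm i x = ∫ ω, f i (x + ν i • u i ω) ∂P)
    (G : ∀ _ : Fin m, EuclideanSpace ℝ (Fin n) → Ω → EuclideanSpace ℝ (Fin n))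
    (hG : ∀ i x ω, G i x ω = ((F i (x + ν i • u i ω) (ξ i ω) - F i x (ξ i ω)) / ν i) • u i ω)
    (σfν2 : ℝ)
    (hσfν2 : σfν2 = (∑ i, (4 * ((n : ℝ) + 2) * (M i) ^ 2 * (ν i) ^ 2
        + (L i) ^ 2 * (ν i) ^ 4 * (n : ℝ) ^ 2)) + 2 * ∑ i, (σf i) ^ 2)
    (B : Fin m → ℝ)
    (hB : ∀ i, B i = ν i / 2 * L i * ((n : ℝ) + 3) ^ ((3 : ℝ) / 2) + L i * D_X + M i)
    (σν2 : Fin m → ℝ)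
    (hσν2 : ∀ i, σν2 i = (ν i) ^ 2 * (L i) ^ 2 * ((n : ℝ) + 6) ^ 3
        + 10 * ((n : ℝ) + 4) * ((σ i) ^ 2 + (B i) ^ 2)) :
    ∀ x : EuclideanSpace ℝ (Fin n), ∀ d : EuclideanSpace ℝ (Fin n), ‖d‖ ≤ D_X →
      ∫ ω, ∑ i, (F i (x + ν i • u i ω) (ξ i ω) - fsm i x
          + ⟪G i x ω - gradient (fsm i) x, d⟫) ^ 2 ∂P
        ≤ 2 * σfν2 + 2 * D_X ^ 2 * ∑ i, σν2 i := by
  intro x d hd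
  have : NeZero n := ⟨by omega⟩
  have hdist : ‖EuclideanSpace.single (0 : Fin n) (1 : ℝ) - 0‖ = 1 := by simp
  have hM : ∀ i, 0 ≤ M i := fun i => by
    obtain ⟨ω, hω⟩ := (hlip i).exists
    have h := (abs_nonneg _).trans (hω (EuclideanSpace.single (0 : Fin n) (1 : ℝ)) 0)
    rwa [hdist, mul_one] at h
  have hL : ∀ i, 0 ≤ L i := fun i => by
    obtain ⟨ω, hω⟩ := (hgradlip i).exists
    have h := (norm_nonneg _).trans (hω (EuclideanSpace.single (0 : Fin n) (1 : ℝ)) 0)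
    rwa [hdist, mul_one] at h
  have hMB : ∀ i, M i ≤ B i := fun i => by
    rw [hB]
    have h1 := (hν i).le
    have h2 := hL i
    have : 0 ≤ ν i / 2 * L i * ((n : ℝ) + 3) ^ ((3 : ℝ) / 2) + L i * D_X := by positivity
    linarith
  have hMσ : ∀ i, (6 * n + 2) * M i ^ 2 ≤ σν2 i := fun i => by
    rw [hσν2]
    have h0 := hM i
    have h1 : M i ^ 2 ≤ B i ^ 2 := pow_le_pow_left₀ h0 (hMB i) 2
    have h2 : 0 ≤ ν i ^ 2 * L i ^ 2 * ((n : ℝ) + 6) ^ 3 := by positivity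
    have h3 : 0 ≤ 10 * ((n : ℝ) + 4) * σ i ^ 2 := by positivity
    have h4 : (6 * (n : ℝ) + 2) * M i ^ 2 ≤ 10 * ((n : ℝ) + 4) * B i ^ 2 :=
      mul_le_mul (by linarith [n.cast_nonneg (α := ℝ)]) h1 (sq_nonneg _) (by positivity)
    linarith
  have hσν_nonneg : ∀ i, 0 ≤ σν2 i := fun i => le_trans (by positivity) (hMσ i)
  have hσf : ∑ i, σf i ^ 2 ≤ σfν2 := by
    rw [hσfν2]
    have h1 : 0 ≤ ∑ i, (4 * ((n : ℝ) + 2) * (M i) ^ 2 * (ν i) ^ 2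
        + (L i) ^ 2 * (ν i) ^ 4 * (n : ℝ) ^ 2) := Finset.sum_nonneg fun i _ => by positivity
    have h2 : 0 ≤ ∑ i, σf i ^ 2 := Finset.sum_nonneg fun i _ => sq_nonneg _
    linarith
  have hbound : 2 * ∑ i, (σf i ^ 2 + D_X ^ 2 * σν2 i)
      ≤ 2 * σfν2 + 2 * D_X ^ 2 * ∑ i, σν2 i := by
    rw [Finset.sum_add_distrib, ← Finset.mul_sum]
    linarith
  have hYmeas : ∀ i, Measurable fun ω => F i (x + ν i • u i ω) (ξ i ω) := fun i =>
    (hFmeas i).comp (Measurable.prodMk ((humeas i).const_smul (ν i) |>.const_add x) (hξmeas i))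
  have hGmeas : ∀ i, Measurable (G i x) := fun i => by
    have h1 : Measurable fun ω => F i x (ξ i ω) :=
      (hFmeas i).comp (measurable_const.prodMk (hξmeas i))
    have h2 := hYmeas i
    have h3 := humeas i
    rw [show G i x = _ from funext (hG i x)]
    fun_prop
  have hXmeas : ∀ i, Measurable fun ω => F i (x + ν i • u i ω) (ξ i ω) - fsm i x
      + ⟪G i x ω - gradient (fsm i) x, d⟫ := fun i => by
    have h2 := hYmeas i
    have h3 := hGmeas i
    fun_prop
  by_cases hint : Integrable (fun ω => ∑ i, (F i (x + ν i • u i ω) (ξ i ω) - fsm i x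
      + ⟪G i x ω - gradient (fsm i) x, d⟫) ^ 2) P
  swap
  · rw [integral_undef hint]
    refine le_trans ?_ hbound
    have : ∀ i, 0 ≤ σf i ^ 2 + D_X ^ 2 * σν2 i := fun i =>
      add_nonneg (sq_nonneg _) (mul_nonneg (sq_nonneg _) (hσν_nonneg i))
    exact mul_nonneg zero_le_two (Finset.sum_nonneg fun i _ => this i)
  have hXint : ∀ i, Integrable (fun ω => (F i (x + ν i • u i ω) (ξ i ω) - fsm i x
      + ⟪G i x ω - gradient (fsm i) x, d⟫) ^ 2) P := fun i => by
    refine hint.mono' ((hXmeas i).pow_const 2).aestronglyMeasurable (.of_forall fun ω => ?_)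
    rw [Real.norm_eq_abs, abs_of_nonneg (sq_nonneg _)]
    exact Finset.single_le_sum (f := fun i => (F i (x + ν i • u i ω) (ξ i ω) - fsm i x
      + ⟪G i x ω - gradient (fsm i) x, d⟫) ^ 2) (fun j _ => sq_nonneg _) (Finset.mem_univ i)
  rw [integral_finsetSum _ fun i _ => hXint i]
  refine le_trans ?_ hbound
  rw [Finset.mul_sum]
  refine Finset.sum_le_sum fun i _ => ?_
  have hX : MemLp (fun ω => F i (x + ν i • u i ω) (ξ i ω) - fsm i x
      + ⟪G i x ω - gradient (fsm i) x, d⟫) 2 P :=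
    (memLp_two_iff_integrable_sq (hXmeas i).aestronglyMeasurable).2 (hXint i)
  have hY : MemLp (fun ω => F i (x + ν i • u i ω) (ξ i ω)) 2 P := by
    have h := (integral_sq_inner_estimator_sub_le (x := x) (d := d) (g := 0) (hν i) (hM i) (hu i)
      (humeas i) (hξmeas i) (hFmeas i) (hlip i) (by simpa using hM i)).1
    have hc := (hX.sub h).add (memLp_const (μ := P) (p := 2)
      (fsm i x + ⟪gradient (fsm i) x, d⟫))
    refine hc.ae_eq (.of_forall fun ω => ?_)
    simp only [Pi.add_apply, Pi.sub_apply, hG, inner_sub_left, inner_zero_left]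
    ring
  have hflip : ∀ y z, |f i y - f i z| ≤ M i * ‖y - z‖ := fun y z => by
    rw [← hunbiased i y, ← hunbiased i z]
    exact abs_integral_sub_integral_le (Φ := fun y ω => F i y (ξ i ω)) (hlip i) (fun y =>
      (memLp_two_of_memLp_two_perturbed (hu i) (humeas i) (hξmeas i) (hFmeas i) (hlip i) hY
        y).integrable (by norm_num)) y z
  have hgrad : ‖gradient (fsm i) x‖ ≤ M i :=
    norm_gradient_le_of_lipschitz (hM i) (fun y z => by
      rw [hfsm, hfsm]
      exact abs_smoothing_sub_smoothing_le (hM i) (hu i) (humeas i) hflip y z) x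
  obtain ⟨hb, hb2⟩ := integral_sq_inner_estimator_sub_le (x := x) (d := d) (hν i) (hM i) (hu i)
    (humeas i) (hξmeas i) (hFmeas i) (hlip i) hgrad
  simp_rw [← hG] at hb hb2
  have ha2 := integral_sq_value_noise_le (humeas i) (hξmeas i) (hindep i) (hFmeas i) (hmoment i) hY
  simp_rw [hunbiased, ← hfsm] at ha2
  have ha : MemLp (fun ω => F i (x + ν i • u i ω) (ξ i ω) - fsm i x) 2 P :=
    hY.sub (memLp_const _)
  have hd2 : (6 * n + 2) * M i ^ 2 * ‖d‖ ^ 2 ≤ D_X ^ 2 * σν2 i := by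
    have h1 : ‖d‖ ^ 2 ≤ D_X ^ 2 := pow_le_pow_left₀ (norm_nonneg d) hd 2
    rw [mul_comm (D_X ^ 2)]
    exact mul_le_mul (hMσ i) h1 (sq_nonneg _) (hσν_nonneg i)
  calc _ ≤ ∫ ω, 2 * ((F i (x + ν i • u i ω) (ξ i ω) - fsm i x) ^ 2
        + ⟪G i x ω - gradient (fsm i) x, d⟫ ^ 2) ∂P :=
        integral_mono (hXint i) ((ha.integrable_sq.add hb.integrable_sq).const_mul 2)
          fun ω => add_sq_le
    _ = 2 * (∫ ω, (F i (x + ν i • u i ω) (ξ i ω) - fsm i x) ^ 2 ∂P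
        + ∫ ω, ⟪G i x ω - gradient (fsm i) x, d⟫ ^ 2 ∂P) := by
        rw [integral_const_mul, integral_add ha.integrable_sq hb.integrable_sq]
    _ ≤ _ := by linarith
end
end

section
/- Let X ⊆ ℝ^n be a convex set with ‖x' − x''‖ ≤ D_X for all x', x'' ∈ X. Let ω : ℝ^n → ℝ be differentiable with Bregman divergence W(y, x) = ω(y) − ω(x) − ⟨∇ω(x), y − x⟩ satisfying W(y, x) ≥ (1/2)‖y − x‖² for all x, y. Let φ_0 : ℝ^n → ℝ be convex with an L_0-Lipschitz gradient, let φ_1, …, φ_m : ℝ^n → ℝ be convex with L_i-Lipschitz gradients, write φ(x) = (φ_1(x), …, φ_m(x)), ∇φ(x)ᵀ d = (⟨∇φ_i(x), d⟩)_{i=1}^m, and L_f = (Σ L_i²)^{1/2}. Let x, x_{t−1}, x_t, x_{t+1} ∈ X, let y, y_t, y_{t+1} ∈ ℝ^m with y, y_t, y_{t+1} ≥ 0, let δ_t^G ∈ ℝ^n, δ_t^F, δ_{t+1}^F ∈ ℝ^m, q_t ∈ ℝ^m, and θ_t, τ_t, η_t > 0. Define the linearizations ℓ_φ(x_t) = φ(x_{t−1})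 + ∇φ(x_{t−1})ᵀ(x_t − x_{t−1}) and ℓ_φ(x_{t+1}) = φ(x_t) + ∇φ(x_t)ᵀ(x_{t+1} − x_t), set ℓ_F(x_t) = ℓ_φ(x_t) + δ_t^F, ℓ_F(x_{t+1}) = ℓ_φ(x_{t+1}) + δ_{t+1}^F, q_{t+1} = ℓ_F(x_{t+1}) − ℓ_F(x_t), and s_t = ℓ_F(x_t) + θ_t q_t. Suppose y_{t+1} minimizes y' ↦ ⟨−s_t, y'⟩ + (τ_t/2)‖y' − y_t‖₂² over {y' ∈ ℝ^m : y' ≥ 0}, and x_{t+1} minimizes x' ↦ ⟨V_t, x'⟩ + η_t W(x', x_t) over X, where V_t = ∇φ_0(x_t) + Σ_{i=1}^m y_{i,t+1} ∇φ_i(x_t) + δ_t^G. Define L_ν(x', y') = φ_0(x') + Σ_{i=1}^m y'_i φ_i(x') and Q_ν(z_{t+1}, z) = L_ν(x_{t+1}, y) − L_ν(x, y_{t+1}). Then Q_ν(z_{t+1}, z) + ⟨q_{t+1}, y_{t+1} − y⟩ − θ_t ⟨q_t, y_t − y⟩ + ⟨δ_t^G, x_t − x⟩ − ⟨δ_{t+1}^F,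 y_{t+1} − y⟩ ≤ θ_t ⟨q_t, y_{t+1} − y_t⟩ − ⟨δ_t^G, x_{t+1} − x_t⟩ + η_t W(x, x_t) − η_t W(x, x_{t+1}) + (τ_t/2)[‖y − y_t‖₂² − ‖y_{t+1} − y_t‖₂² − ‖y − y_{t+1}‖₂²] − (η_t − L_0 − L_f) W(x_{t+1}, x_t) + (L_f D_X / 2) [‖y‖₂ − 1]₊ ‖x_{t+1} − x_t‖. -/
open MeasureTheory ProbabilityTheory Real Finset
open scoped RealInnerProductSpace

noncomputable section

/-- A function with a one-sided minimum at the origin has nonnegative derivative there. -/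
theorem HasDerivAt.nonneg_of_le_on_Ioc {g : ℝ → ℝ} {g' : ℝ} (h : HasDerivAt g g' 0)
    (hg : ∀ t ∈ Set.Ioc (0 : ℝ) 1, g 0 ≤ g t) : 0 ≤ g' := by
  refine ge_of_tendsto h.tendsto_slope_zero_right ?_
  filter_upwards [Ioc_mem_nhdsGT (zero_lt_one' ℝ)] with t ht
  rw [zero_add, smul_eq_mul]
  exact mul_nonneg (inv_nonneg.2 ht.1.le) (sub_nonneg.2 (hg t ht))

section Gradient

variable {E : Type*} [NormedAddCommGroup E] [InnerProductSpace ℝ E] [CompleteSpace E]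

theorem hasDerivAt_comp_segment {f : E → ℝ} (hf : Differentiable ℝ f) (a v : E) (t : ℝ) :
    HasDerivAt (fun t : ℝ => f (a + t • v)) ⟪gradient f (a + t • v), v⟫ t := by
  have hl : HasDerivAt (fun t : ℝ => a + t • v) v t := by
    simpa using ((hasDerivAt_id t).smul_const v).const_add a
  exact (hf (a + t • v)).hasGradientAt.hasFDerivAt.comp_hasDerivAt t hl

/-- A differentiable convex function lies above its tangents. -/
theorem ConvexOn.tangent_le {f : E → ℝ} (hc : ConvexOn ℝ Set.univ f) (hf : Differentiable ℝ f)
    (a b : E) : f a + ⟪gradient f a, b - a⟫ ≤ f b := by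
  have hd := ((hasDerivAt_id (0 : ℝ)).mul_const (f b - f a)).sub
    (hasDerivAt_comp_segment hf a (b - a) 0)
  have key := hd.nonneg_of_le_on_Ioc fun t ht => by
    have h := hc.2 (Set.mem_univ a) (Set.mem_univ b) (sub_nonneg.2 ht.2) ht.1.le
      (sub_add_cancel 1 t)
    have e : (1 - t) • a + t • b = a + t • (b - a) := by module
    rw [e] at h
    simp only [smul_eq_mul] at h
    simp only [Pi.sub_apply, id, zero_smul, add_zero]
    linarith
  simp only [zero_smul, add_zero] at key
  linarith

/-- The descent lemma for functions with Lipschitz gradient. -/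
theorem le_tangent_add_of_gradient_lipschitz {f : E → ℝ} {L : ℝ} (hf : Differentiable ℝ f)
    (hL : ∀ a b, ‖gradient f a - gradient f b‖ ≤ L * ‖a - b‖) (a b : E) :
    f b ≤ f a + ⟪gradient f a, b - a⟫ + L / 2 * ‖b - a‖ ^ 2 := by
  have hd (t : ℝ) := ((hasDerivAt_comp_segment hf a (b - a) t).sub
    ((hasDerivAt_id t).mul_const ⟪gradient f a, b - a⟫)).sub
    (((hasDerivAt_id t).pow 2).mul_const (L / 2 * ‖b - a‖ ^ 2))
  have anti := antitoneOn_of_deriv_nonpos (convex_Icc (0 : ℝ) 1)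
    (fun t _ => (hd t).continuousAt.continuousWithinAt)
    (fun t _ => (hd t).differentiableAt.differentiableWithinAt) (fun t ht => by
      rw [interior_Icc] at ht
      rw [(hd t).deriv]
      have h1 := real_inner_le_norm (gradient f (a + t • (b - a)) - gradient f a) (b - a)
      have h2 := mul_le_mul_of_nonneg_right (hL (a + t • (b - a)) a) (norm_nonneg (b - a))
      rw [add_sub_cancel_left, norm_smul, Real.norm_of_nonneg ht.1.le] at h2
      rw [inner_sub_left] at h1
      simp only [id, Nat.cast_ofNat, Nat.reduceSub, pow_one]
      linarith)
  have key := anti (Set.left_mem_Icc.2 zero_le_one) (Set.right_mem_Icc.2 zero_le_one) zero_le_one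
  simp only [Pi.sub_apply, Pi.pow_apply, id, one_smul, zero_smul, add_zero,
    add_sub_cancel] at key
  linarith

/-- The three-point inequality for a Bregman proximal step over a convex set. -/
theorem inner_le_of_bregman_prox {X : Set E} (hX : Convex ℝ X) {w : E → ℝ}
    (hw : Differentiable ℝ w) {W : E → E → ℝ}
    (hW : ∀ b a, W b a = w b - w a - ⟪gradient w a, b - a⟫) {V p c x : E} {η : ℝ}
    (hx : x ∈ X) (hp : p ∈ X) (hmin : ∀ x' ∈ X, ⟪V, p⟫ + η * W p c ≤ ⟪V, x'⟫ + η * W x' c) :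
    ⟪V, p - x⟫ ≤ η * W x c - η * W x p - η * W p c := by
  have hd := ((hasDerivAt_id (0 : ℝ)).mul_const ⟪V - η • gradient w c, x - p⟫).add
    ((hasDerivAt_comp_segment hw p (x - p) 0).const_mul η)
  have key := hd.nonneg_of_le_on_Ioc fun t ht => by
    have h := hmin (p + t • (x - p)) (hX.add_smul_sub_mem hp hx ⟨ht.1.le, ht.2⟩)
    simp only [hW, inner_add_right, inner_sub_right, inner_smul_right] at h
    simp only [Pi.add_apply, id, zero_smul, add_zero, inner_sub_left, inner_sub_right,
      real_inner_smul_left]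
    linarith
  simp only [zero_smul, add_zero, inner_sub_left, inner_sub_right, real_inner_smul_left] at key
  simp only [hW, inner_sub_right]
  linarith

end Gradient

/-- The three-point inequality for a Euclidean proximal step over the nonnegative orthant. -/
theorem sum_le_of_orthant_prox {ι : Type*} [Fintype ι] {s p c y : ι → ℝ} {τ : ℝ}
    (hy : ∀ i, 0 ≤ y i) (hp : ∀ i, 0 ≤ p i)
    (hmin : ∀ y' : ι → ℝ, (∀ i, 0 ≤ y' i) →
      (∑ i, (-(s i)) * p i) + τ / 2 * ∑ i, (p i - c i) ^ 2
        ≤ (∑ i, (-(s i)) * y' i) + τ / 2 * ∑ i, (y' i - c i) ^ 2) :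
    ∑ i, (-(s i)) * (p i - y i) ≤ τ / 2 * ((∑ i, (y i - c i) ^ 2) - (∑ i, (p i - c i) ^ 2)
      - (∑ i, (y i - p i) ^ 2)) := by
  have hd := ((hasDerivAt_id (0 : ℝ)).mul_const
    (∑ i, ((-(s i)) * (y i - p i) + τ * ((p i - c i) * (y i - p i))))).add
    (((hasDerivAt_id (0 : ℝ)).pow 2).mul_const (∑ i, τ / 2 * (y i - p i) ^ 2))
  have key := hd.nonneg_of_le_on_Ioc fun t ht => by
    have h := hmin (fun i => p i + t * (y i - p i)) fun i => by
      nlinarith [mul_nonneg ht.1.le (hy i), mul_nonneg (sub_nonneg.2 ht.2) (hp i)]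
    rw [← sub_nonneg] at h ⊢
    convert h using 1
    simp only [Pi.add_apply, Pi.pow_apply, id, mul_sum, ← sum_add_distrib, ← sum_sub_distrib]
    refine sum_congr rfl fun i _ => ?_
    ring
  have e : τ / 2 * ((∑ i, (y i - c i) ^ 2) - (∑ i, (p i - c i) ^ 2) - (∑ i, (y i - p i) ^ 2))
      - ∑ i, (-(s i)) * (p i - y i)
      = ∑ i, ((-(s i)) * (y i - p i) + τ * ((p i - c i) * (y i - p i))) := by
    simp only [mul_sub, mul_sum, ← sum_sub_distrib]
    refine sum_congr rfl fun i _ => ?_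
    ring
  simp only [id, one_mul, Nat.reduceSub, pow_one, mul_zero, zero_mul, add_zero] at key
  linarith

/-- one-iteration inequality of the constraint-extrapolation method.
The Euclidean inner product on `ℝ^m` is written out as `∑ i, a i * b i` and the
squared Euclidean norm as `∑ i, (a i)²`. -/
theorem statement17
    {n m : ℕ}
    (X : Set (EuclideanSpace ℝ (Fin n))) (hX : Convex ℝ X) (D_X : ℝ)
    (hD : ∀ x' ∈ X, ∀ x'' ∈ X, ‖x' - x''‖ ≤ D_X)
    (w : EuclideanSpace ℝ (Fin n) → ℝ) (hw : Differentiable ℝ w)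
    (W : EuclideanSpace ℝ (Fin n) → EuclideanSpace ℝ (Fin n) → ℝ)
    (hWdef : ∀ b a, W b a = w b - w a - ⟪gradient w a, b - a⟫)
    (hWlb : ∀ b a, W b a ≥ 1 / 2 * ‖b - a‖ ^ 2)
    (φ0 : EuclideanSpace ℝ (Fin n) → ℝ) (L0 : ℝ)
    (hconv0 : ConvexOn ℝ Set.univ φ0) (hdiff0 : Differentiable ℝ φ0)
    (hgl0 : ∀ a b, ‖gradient φ0 a - gradient φ0 b‖ ≤ L0 * ‖a - b‖)
    (φ : Fin m → EuclideanSpace ℝ (Fin n) → ℝ) (L : Fin m → ℝ)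
    (hconv : ∀ i, ConvexOn ℝ Set.univ (φ i)) (hdiff : ∀ i, Differentiable ℝ (φ i))
    (hgl : ∀ i a b, ‖gradient (φ i) a - gradient (φ i) b‖ ≤ L i * ‖a - b‖)
    (Lf : ℝ) (hLf : Lf = Real.sqrt (∑ i, (L i) ^ 2))
    (x xtm1 xt xt1 : EuclideanSpace ℝ (Fin n))
    (hx : x ∈ X) (hxtm1 : xtm1 ∈ X) (hxt : xt ∈ X) (hxt1 : xt1 ∈ X)
    (y yt yt1 : Fin m → ℝ)
    (hy : ∀ i, 0 ≤ y i) (hyt : ∀ i, 0 ≤ yt i) (hyt1 : ∀ i, 0 ≤ yt1 i)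
    (δG : EuclideanSpace ℝ (Fin n)) (δF δF' qt : Fin m → ℝ)
    (θ τ η : ℝ) (hθ : 0 < θ) (hτ : 0 < τ) (hη : 0 < η)
    (ℓφt ℓφt1 ℓFt ℓFt1 qt1 s : Fin m → ℝ)
    (hℓφt : ∀ i, ℓφt i = φ i xtm1 + ⟪gradient (φ i) xtm1, xt - xtm1⟫)
    (hℓφt1 : ∀ i, ℓφt1 i = φ i xt + ⟪gradient (φ i) xt, xt1 - xt⟫)
    (hℓFt : ∀ i, ℓFt i = ℓφt i + δF i)
    (hℓFt1 : ∀ i, ℓFt1 i = ℓφt1 i + δF' i)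
    (hqt1 : ∀ i, qt1 i = ℓFt1 i - ℓFt i)
    (hs : ∀ i, s i = ℓFt i + θ * qt i)
    (hymin : ∀ y' : Fin m → ℝ, (∀ i, 0 ≤ y' i) →
      (∑ i, (-(s i)) * yt1 i) + τ / 2 * ∑ i, (yt1 i - yt i) ^ 2
        ≤ (∑ i, (-(s i)) * y' i) + τ / 2 * ∑ i, (y' i - yt i) ^ 2)
    (V : EuclideanSpace ℝ (Fin n))
    (hV : V = gradient φ0 xt + (∑ i, yt1 i • gradient (φ i) xt) + δG)
    (hxmin : ∀ x' ∈ X, ⟪V, xt1⟫ + η * W xt1 xt ≤ ⟪V, x'⟫ + η * W x' xt)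
    (Lν : EuclideanSpace ℝ (Fin n) → (Fin m → ℝ) → ℝ)
    (hLν : ∀ x' y', Lν x' y' = φ0 x' + ∑ i, y' i * φ i x')
    (Q : ℝ) (hQ : Q = Lν xt1 y - Lν x yt1) :
    Q + (∑ i, qt1 i * (yt1 i - y i)) - θ * (∑ i, qt i * (yt i - y i))
        + ⟪δG, xt - x⟫ - (∑ i, δF' i * (yt1 i - y i))
      ≤ θ * (∑ i, qt i * (yt1 i - yt i)) - ⟪δG, xt1 - xt⟫
        + η * W x xt - η * W x xt1
        + τ / 2 * ((∑ i, (y i - yt i) ^ 2) - (∑ i, (yt1 i - yt i) ^ 2)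
            - (∑ i, (y i - yt1 i) ^ 2))
        - (η - L0 - Lf) * W xt1 xt
        + Lf * D_X / 2 * max (Real.sqrt (∑ i, (y i) ^ 2) - 1) 0 * ‖xt1 - xt‖ := by
  have hxopt := inner_le_of_bregman_prox hX hw hWdef hx hxt1 hxmin
  have hyopt := sum_le_of_orthant_prox hy hyt1 hymin
  have h0up := le_tangent_add_of_gradient_lipschitz hdiff0 hgl0 xt xt1
  have h0lo := hconv0.tangent_le hdiff0 xt x
  have hlo : ∑ i, yt1 i * (φ i xt + ⟪gradient (φ i) xt, x - xt⟫) ≤ ∑ i, yt1 i * φ i x :=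
    sum_le_sum fun i _ => mul_le_mul_of_nonneg_left ((hconv i).tangent_le (hdiff i) xt x) (hyt1 i)
  have hup : ∑ i, y i * φ i xt1 ≤ ∑ i, y i * (ℓφt1 i + L i / 2 * ‖xt1 - xt‖ ^ 2) :=
    sum_le_sum fun i _ => mul_le_mul_of_nonneg_left
      (hℓφt1 i ▸ le_tangent_add_of_gradient_lipschitz (hdiff i) (hgl i) xt xt1) (hy i)
  have hcs : ∑ i, y i * L i ≤ Real.sqrt (∑ i, (y i) ^ 2) * Lf :=
    hLf ▸ Real.sum_mul_le_sqrt_mul_sqrt univ y L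
  have hLf0 : 0 ≤ Lf := hLf ▸ Real.sqrt_nonneg _
  have hV' : ⟪V, xt1 - x⟫ = ⟪gradient φ0 xt, xt1 - x⟫
      + ∑ i, yt1 i * ⟪gradient (φ i) xt, xt1 - x⟫ + ⟪δG, xt1 - x⟫ := by
    simp only [hV, inner_add_left, sum_inner, real_inner_smul_left]
  have hsmooth : (L0 + Lf) / 2 * ‖xt1 - xt‖ ^ 2 ≤ (L0 + Lf) * W xt1 xt := by
    rcases eq_or_ne xt1 xt with rfl | hne
    · simp [hWdef]
    · have hL0 : 0 ≤ L0 := nonneg_of_mul_nonneg_left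
        ((norm_nonneg _).trans (hgl0 xt1 xt)) (norm_sub_pos_iff.2 hne)
      linarith [mul_le_mul_of_nonneg_left (hWlb xt1 xt) (add_nonneg hL0 hLf0)]
  have hres : (∑ i, y i * L i) / 2 * ‖xt1 - xt‖ ^ 2 ≤ Lf / 2 * ‖xt1 - xt‖ ^ 2
      + Lf * D_X / 2 * max (Real.sqrt (∑ i, (y i) ^ 2) - 1) 0 * ‖xt1 - xt‖ := by
    set r := Real.sqrt (∑ i, (y i) ^ 2)
    set d := ‖xt1 - xt‖
    have hd : 0 ≤ d := norm_nonneg _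
    have hdD : d ≤ D_X := hD xt1 hxt1 xt hxt
    have h1 := mul_le_mul_of_nonneg_right hcs (sq_nonneg d)
    have h2 := mul_le_mul_of_nonneg_right (le_max_left (r - 1) 0) (mul_nonneg hLf0 (sq_nonneg d))
    have h3 := mul_le_mul_of_nonneg_left hdD
      (mul_nonneg (mul_nonneg hLf0 (le_max_right (r - 1) 0)) hd)
    linarith
  have hlin : (∑ i, y i * (ℓφt1 i + L i / 2 * ‖xt1 - xt‖ ^ 2))
      - (∑ i, yt1 i * (φ i xt + ⟪gradient (φ i) xt, x - xt⟫))
      + (∑ i, qt1 i * (yt1 i - y i)) - θ * (∑ i, qt i * (yt i - y i))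
      - (∑ i, δF' i * (yt1 i - y i))
      = (∑ i, yt1 i * ⟪gradient (φ i) xt, xt1 - x⟫) + (∑ i, y i * L i) / 2 * ‖xt1 - xt‖ ^ 2
        + (∑ i, (-(s i)) * (yt1 i - y i)) + θ * (∑ i, qt i * (yt1 i - yt i)) := by
    simp only [mul_sum, sum_div, sum_mul, ← sum_add_distrib, ← sum_sub_distrib]
    refine sum_congr rfl fun i _ => ?_
    simp only [hs, hqt1, hℓFt1, hℓφt1, inner_sub_right]
    ring
  rw [hQ, hLν, hLν]
  simp only [inner_sub_right] at h0up h0lo hV' hxopt hlin hlo ⊢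
  linarith
end
end

section
/- Let X ⊆ ℝ^n be a convex set with ‖x' − x''‖ ≤ D_X for all x', x'' ∈ X. Let ω : ℝ^n → ℝ be differentiable with Bregman divergence W(y, x) = ω(y) − ω(x) − ⟨∇ω(x), y − x⟩ satisfying W(y, x) ≥ (1/2)‖y − x‖² for all x, y. Let φ_0 : ℝ^n → ℝ be convex with an L_0-Lipschitz gradient, and let φ_1, …, φ_m : ℝ^n → ℝ be convex with L_i-Lipschitz gradients and with ‖∇φ_i(x)‖ ≤ M_i for all x; write φ(x) = (φ_1(x), …, φ_m(x)), ∇φ(x)ᵀ d = (⟨∇φ_i(x), d⟩)_{i=1}^m, M_f = (Σ M_i²)^{1/2}, L_f = (Σ L_i²)^{1/2}. Let T ≥ 1 and let {γ_t, θ_t, τ_t, η_t}_{0 ≤ t ≤ T−1} be positive parameters with η_t > L_0 + L_f for all t, satisfying for all 1 ≤ t ≤ T−1 (with the convention η_s = η_0 for s < 0, θ_0 arbitrary positive): γ_t θ_t = γ_{t−1}, γ_t τ_t ≤ γ_{t−1} τ_{t−1}, γ_t η_t ≤ γ_{t−1} η_{t−1}, (2M_f)² θ_t/θ_{t−1} ≤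 τ_t (η_{t−2} − L_0 − L_f)/12, θ_t M_f² ≤ τ_t (η_{t−1} − L_0 − L_f)/12, and additionally (2M_f)²/θ_{T−1} ≤ τ_{T−1} (η_{T−2} − L_0 − L_f)/12 and M_f² ≤ τ_{T−1} (η_{T−1} − L_0 − L_f)/12. Let x_0 ∈ X with the convention x_{−1} = x_0, let y_0 ∈ ℝ^m with y_0 ≥ 0, let δ_t^G ∈ ℝ^n and δ_t^F ∈ ℝ^m be given for 0 ≤ t ≤ T, and generate sequences {x_t}_{0 ≤ t ≤ T} ⊆ X, {y_t}_{0 ≤ t ≤ T} as follows: with ℓ_φ(x_t) = φ(x_{t−1}) + ∇φ(x_{t−1})ᵀ(x_t − x_{t−1}), ℓ_F(x_t) = ℓ_φ(x_t) + δ_t^F for t ≥ 0, and the convention ℓ_F(x_{−1}) = ℓ_F(x_0); q_t = ℓ_F(x_t) − ℓ_F(x_{t−1}), q̄_t = ℓ_φ(x_t) − ℓ_φ(x_{t−1}); s_t = (1 + θ_t) ℓ_F(x_t) − θ_t ℓ_F(x_{t−1}); y_{t+1} minimizes y' ↦ ⟨−s_t, y'⟩ + (τ_t/2)‖y' − y_t‖₂²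 over {y' ≥ 0}; and x_{t+1} minimizes x' ↦ ⟨V_t, x'⟩ + η_t W(x', x_t) over X, where V_t = ∇φ_0(x_t) + Σ_{i=1}^m y_{i,t+1} ∇φ_i(x_t) + δ_t^G. Define L_ν(x', y') = φ_0(x') + Σ_{i=1}^m y'_i φ_i(x') and Q_ν(z_{t+1}, z) = L_ν(x_{t+1}, y) − L_ν(x, y_{t+1}) for z = (x, y). Then for every x ∈ X and y ∈ ℝ^m with y ≥ 0: Σ_{t=0}^{T−1} γ_t Q_ν(z_{t+1}, z) + Σ_{t=0}^{T−1} γ_t [⟨δ_t^G, x_t − x⟩ − ⟨δ_{t+1}^F, y_{t+1} − y⟩] ≤ γ_0 η_0 W(x, x_0) − γ_{T−1} η_{T−1} W(x, x_T) + (γ_0 τ_0/2)‖y − y_0‖₂² − (γ_{T−1} τ_{T−1}/12)‖y − y_T‖₂² + Σ_{t=0}^{T−1} (2γ_t/(η_t − L_0 − L_f)) [ ‖δ_t^G‖² + ((L_f D_X/2)[‖y‖₂ − 1]₊)² ] + Σ_{t=1}^{T−1} (3γ_t θ_t²/(2τ_t)) ‖q_t − q̄_t‖₂² + (3γ_{T−1}/(2τ_{T−1}))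 ‖q_T − q̄_T‖₂². -/
open MeasureTheory ProbabilityTheory Real Finset
open scoped RealInnerProductSpace

noncomputable section

section Gradient

variable {E : Type*} [NormedAddCommGroup E] [InnerProductSpace ℝ E] [CompleteSpace E] {f : E → ℝ}

lemma Differentiable.hasDerivAt_comp_line (hf : Differentiable ℝ f) (a d : E) (r : ℝ) :
    HasDerivAt (fun r : ℝ => f (a + r • d)) ⟪gradient f (a + r • d), d⟫ r := by
  have hline : HasDerivAt (fun r : ℝ => a + r • d) d r := by
    simpa using ((hasDerivAt_id r).smul_const d).const_add a
  rw [inner_gradient_left]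
  exact (hf (a + r • d)).hasFDerivAt.comp_hasDerivAt r hline

/-- First-order characterisation of convexity. -/
lemma ConvexOn.add_inner_gradient_le (hc : ConvexOn ℝ Set.univ f) (hf : Differentiable ℝ f)
    (a b : E) : f a + ⟪gradient f a, b - a⟫ ≤ f b := by
  have hc' : ConvexOn ℝ Set.univ (fun r : ℝ => f (a + r • (b - a))) := by
    refine ⟨convex_univ, fun r _ u _ p q hp hq hpq => ?_⟩
    have h := hc.2 (Set.mem_univ (a + r • (b - a))) (Set.mem_univ (a + u • (b - a))) hp hq hpq
    have hpt : p • (a + r • (b - a)) + q • (a + u • (b - a))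
        = a + (p • r + q • u) • (b - a) := by
      obtain rfl : p = 1 - q := by linarith
      simp only [smul_eq_mul]
      module
    rwa [hpt] at h
  have h := hc'.le_slope_of_hasDerivAt (Set.mem_univ 0) (Set.mem_univ 1) one_pos
    (hf.hasDerivAt_comp_line a (b - a) 0)
  simp only [slope_def_field, zero_smul, one_smul, add_zero, add_sub_cancel, sub_zero, div_one]
    at h
  linarith

/-- The descent lemma for functions with Lipschitz gradient. -/
lemma Differentiable.le_add_inner_gradient_add_sq (hf : Differentiable ℝ f) {K : ℝ}
    (hK : ∀ a b, ‖gradient f a - gradient f b‖ ≤ K * ‖a - b‖) (a b : E) :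
    f b ≤ f a + ⟪gradient f a, b - a⟫ + K / 2 * ‖b - a‖ ^ 2 := by
  set d := b - a with hd
  have hder : ∀ r : ℝ, HasDerivAt
      (fun r : ℝ => f (a + r • d) - r * ⟪gradient f a, d⟫ - K / 2 * ‖d‖ ^ 2 * r ^ 2)
      (⟪gradient f (a + r • d), d⟫ - ⟪gradient f a, d⟫ - K * ‖d‖ ^ 2 * r) r := by
    intro r
    have h := ((hf.hasDerivAt_comp_line a d r).sub
      ((hasDerivAt_id r).mul_const ⟪gradient f a, d⟫)).sub
      ((hasDerivAt_pow 2 r).const_mul (K / 2 * ‖d‖ ^ 2))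
    exact h.congr_deriv (by norm_num; ring)
  have hanti : AntitoneOn
      (fun r : ℝ => f (a + r • d) - r * ⟪gradient f a, d⟫ - K / 2 * ‖d‖ ^ 2 * r ^ 2)
      (Set.Icc 0 1) := by
    refine antitoneOn_of_deriv_nonpos (convex_Icc 0 1)
      (fun r _ => (hder r).continuousAt.continuousWithinAt)
      (fun r _ => (hder r).differentiableAt.differentiableWithinAt) fun r hr => ?_
    rw [interior_Icc] at hr
    rw [(hder r).deriv, ← inner_sub_left]
    have h1 := real_inner_le_norm (gradient f (a + r • d) - gradient f a) d
    have h2 := hK (a + r • d) a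
    rw [add_sub_cancel_left, norm_smul, Real.norm_of_nonneg hr.1.le] at h2
    nlinarith [mul_le_mul_of_nonneg_right h2 (norm_nonneg d)]
  have h := hanti (Set.left_mem_Icc.2 zero_le_one) (Set.right_mem_Icc.2 zero_le_one) zero_le_one
  simp only [zero_smul, one_smul, add_zero, hd, add_sub_cancel] at h
  linarith

/-- Three-point inequality for a Bregman proximal step. -/
lemma bregman_prox_inequality {X : Set E} (hX : Convex ℝ X) (hf : Differentiable ℝ f)
    {W : E → E → ℝ} (hW : ∀ b a, W b a = f b - f a - ⟪gradient f a, b - a⟫)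
    {v a p : E} {c : ℝ} (hp : p ∈ X)
    (hmin : ∀ z ∈ X, ⟪v, p⟫ + c * W p a ≤ ⟪v, z⟫ + c * W z a) {z : E} (hz : z ∈ X) :
    ⟪v, p - z⟫ ≤ c * (W z a - W z p - W p a) := by
  have hder : HasFDerivAt (fun z => ⟪v, z⟫ + c * W z a)
      (innerSL ℝ v + c • (fderiv ℝ f p - innerSL ℝ (gradient f a))) p := by
    have h1 : HasFDerivAt (fun z => ⟪v, z⟫) (innerSL ℝ v) p := (innerSL ℝ v).hasFDerivAt
    have h2 : HasFDerivAt (fun z => W z a) (fderiv ℝ f p - innerSL ℝ (gradient f a)) p := by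
      have h3 : HasFDerivAt (fun z => ⟪gradient f a, z - a⟫) (innerSL ℝ (gradient f a)) p := by
        exact (innerSL ℝ (gradient f a)).hasFDerivAt.comp p ((hasFDerivAt_id p).sub_const a)
      simp only [hW]
      exact ((hf p).hasFDerivAt.sub_const (f a)).sub h3
    exact h1.add (h2.const_mul c)
  have hlocal : IsLocalMinOn (fun z => ⟪v, z⟫ + c * W z a) X p :=
    IsMinOn.localize fun z hz => hmin z hz
  have h := hlocal.hasFDerivWithinAt_nonneg hder.hasFDerivWithinAt
    (sub_mem_posTangentConeAt_of_segment_subset (hX.segment_subset hp hz))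
  simp only [add_apply, smul_apply,
    sub_apply, innerSL_apply_apply, ← inner_gradient_left, smul_eq_mul,
    inner_sub_right] at h
  simp only [hW, inner_sub_right]
  linarith

/-- The linearisations of a function with bounded gradient at consecutive points `a₀, a₁, a₂`
differ by at most a multiple of the step lengths. -/
lemma ConvexOn.abs_linearization_sub_le (hc : ConvexOn ℝ Set.univ f) (hf : Differentiable ℝ f)
    {K : ℝ} (hK : ∀ a, ‖gradient f a‖ ≤ K) (a₀ a₁ a₂ : E) :
    |f a₁ + ⟪gradient f a₁, a₂ - a₁⟫ - (f a₀ + ⟪gradient f a₀, a₁ - a₀⟫)|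
      ≤ K * (‖a₂ - a₁‖ + 2 * ‖a₁ - a₀‖) := by
  have h1 := hc.add_inner_gradient_le hf a₀ a₁
  have h2 := hc.add_inner_gradient_le hf a₁ a₀
  rw [← neg_sub a₁ a₀, inner_neg_right] at h2
  have hb : ∀ a d, |⟪gradient f a, d⟫| ≤ K * ‖d‖ := fun a d =>
    (abs_real_inner_le_norm _ _).trans (mul_le_mul_of_nonneg_right (hK a) (norm_nonneg d))
  have h3 := abs_le.1 (hb a₁ (a₂ - a₁))
  have h4 := abs_le.1 (hb a₁ (a₁ - a₀))
  have h5 := abs_le.1 (hb a₀ (a₁ - a₀))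
  have h6 : 0 ≤ K * ‖a₁ - a₀‖ := (abs_nonneg _).trans (hb a₁ (a₁ - a₀))
  rw [abs_le]
  constructor <;> linarith [h3.1, h3.2, h4.1, h4.2, h5.1, h5.2]

end Gradient

section Coordinates

variable {ι : Type*} [Fintype ι]

/-- Three-point inequality for a proximal step on the nonnegative orthant. -/
lemma orthant_prox_inequality {s y p : ι → ℝ} {c : ℝ} (hp : ∀ i, 0 ≤ p i)
    (hmin : ∀ z : ι → ℝ, (∀ i, 0 ≤ z i) →
      (∑ i, (-(s i)) * p i) + c / 2 * ∑ i, (p i - y i) ^ 2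
        ≤ (∑ i, (-(s i)) * z i) + c / 2 * ∑ i, (z i - y i) ^ 2)
    {z : ι → ℝ} (hz : ∀ i, 0 ≤ z i) :
    -∑ i, s i * (p i - z i) ≤
      c / 2 * ((∑ i, (z i - y i) ^ 2) - (∑ i, (z i - p i) ^ 2) - ∑ i, (p i - y i) ^ 2) := by
  set B := (∑ i, s i * (p i - z i)) + c * ∑ i, (p i - y i) * (z i - p i) with hB
  set C := c / 2 * ∑ i, (z i - p i) ^ 2 with hC
  have hline : ∀ r ∈ Set.Ioc (0 : ℝ) 1, 0 ≤ B + r * C := by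
    intro r hr
    have h := hmin (fun i => p i + r * (z i - p i)) fun i => by
      nlinarith [mul_nonneg hr.1.le (hz i), mul_nonneg (sub_nonneg.2 hr.2) (hp i)]
    have hlin : ∑ i, (-(s i)) * (p i + r * (z i - p i))
        = (∑ i, (-(s i)) * p i) + r * ∑ i, s i * (p i - z i) := by
      rw [mul_sum, ← sum_add_distrib]
      exact sum_congr rfl fun i _ => by ring
    have hquad : ∑ i, (p i + r * (z i - p i) - y i) ^ 2 = (∑ i, (p i - y i) ^ 2)
        + 2 * r * (∑ i, (p i - y i) * (z i - p i)) + r ^ 2 * ∑ i, (z i - p i) ^ 2 := by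
      rw [mul_sum, mul_sum, ← sum_add_distrib, ← sum_add_distrib]
      exact sum_congr rfl fun i _ => by ring
    simp only [hlin, hquad] at h
    refine nonneg_of_mul_nonneg_right (?_ : 0 ≤ r * (B + r * C)) hr.1
    rw [hB, hC]
    linarith
  have hB0 : 0 ≤ B := by
    by_contra! hneg
    rcases le_or_gt C 0 with hC0 | hC0
    · linarith [hline 1 ⟨one_pos, le_rfl⟩]
    · have hr : 0 < min 1 (-B / (2 * C)) := lt_min one_pos (div_pos (neg_pos.2 hneg) (by positivity))
      have h := hline _ ⟨hr, min_le_left _ _⟩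
      have h2 : min 1 (-B / (2 * C)) * C ≤ -B / (2 * C) * C :=
        mul_le_mul_of_nonneg_right (min_le_right _ _) hC0.le
      have h3 : -B / (2 * C) * C = -B / 2 := by field_simp
      linarith
  have hid : (∑ i, (z i - y i) ^ 2) - (∑ i, (z i - p i) ^ 2) - ∑ i, (p i - y i) ^ 2
      = 2 * ∑ i, (p i - y i) * (z i - p i) := by
    rw [mul_sum, ← sum_sub_distrib, ← sum_sub_distrib]
    exact sum_congr rfl fun i _ => by ring
  rw [hid]
  linarith

/-- Young's inequality for a perturbed vector, with separate weights for the two parts. -/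
lemma abs_sum_mul_le_young (q r u : ι → ℝ) {a b : ℝ} (ha : 0 < a) (hb : 0 < b) :
    |∑ i, q i * u i| ≤ (∑ i, (q i - r i) ^ 2) / (4 * a) + (∑ i, (r i) ^ 2) / (4 * b)
      + (a + b) * ∑ i, (u i) ^ 2 := by
  have key : ∀ (v k c : ℝ), 0 < c → |v * k| ≤ v ^ 2 / (4 * c) + c * k ^ 2 := by
    intro v k c hc
    rw [abs_mul, ← sq_abs v, ← sq_abs k, div_add' _ _ _ (by positivity), le_div_iff₀ (by positivity)]
    nlinarith [sq_nonneg (|v| - 2 * c * |k|)]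
  rw [sum_div, sum_div, mul_sum, ← sum_add_distrib, ← sum_add_distrib]
  refine (abs_sum_le_sum_abs _ _).trans (sum_le_sum fun i _ => ?_)
  have h1 := key (q i - r i) (u i) a ha
  have h2 := key (r i) (u i) b hb
  have h3 := abs_add_le ((q i - r i) * u i) (r i * u i)
  rw [← add_mul, sub_add_cancel] at h3
  linarith

end Coordinates

/-- Telescoping of weighted one-step bounds. The sequences `d`, `N`, `K` stand for step lengths,
extrapolation errors and linearisation differences. -/
lemma sum_range_succ_le_of_step_bounds {k : ℕ} {γ θ τ η c A W Y P d N K E : ℕ → ℝ} {Q : ℝ}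
    (hpos : ∀ t ≤ k, 0 < γ t ∧ 0 < θ t ∧ 0 < τ t)
    (hθ : ∀ t < k, γ (t + 1) * θ (t + 1) = γ t)
    (hτ : ∀ t < k, γ (t + 1) * τ (t + 1) ≤ γ t * τ t)
    (hη : ∀ t < k, γ (t + 1) * η (t + 1) ≤ γ t * η t)
    (hc : ∀ t ≤ k, 0 < c t)
    (hfar : ∀ t < k, 4 * Q * θ (t + 1) / θ t ≤ τ (t + 1) * c (t - 1) / 12)
    (hnear : ∀ t < k, θ (t + 1) * Q ≤ τ (t + 1) * c t / 12)
    (hW : ∀ t ≤ k + 1, 0 ≤ W t) (hY : ∀ t ≤ k + 1, 0 ≤ Y t)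
    (hP0 : P 0 = 0) (hN0 : N 0 = 0) (hd0 : d 0 = 0) (hQ : 0 ≤ Q)
    (hK0 : K 0 = 0) (hK : ∀ t < k, K (t + 1) ≤ Q * (d (t + 1) + 2 * d t) ^ 2)
    (hstep : ∀ t ≤ k, A t ≤ η t * (W t - W (t + 1)) + τ t / 2 * (Y t - Y (t + 1))
      + (θ t * P t - P (t + 1)) - c t / 4 * d (t + 1) ^ 2 + E t
      + 3 * θ t ^ 2 / (2 * τ t) * N t + 3 * θ t ^ 2 / (4 * τ t) * K t) :
    ∑ t ∈ range (k + 1), γ t * A t ≤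
      γ 0 * η 0 * W 0 - γ k * η k * W (k + 1) + γ 0 * τ 0 / 2 * Y 0 - γ k * τ k / 2 * Y (k + 1)
      + (∑ t ∈ range (k + 1), γ t * E t)
      + (∑ t ∈ Ico 1 (k + 1), 3 * γ t * θ t ^ 2 / (2 * τ t) * N t)
      - γ k * P (k + 1) - γ k * c k / 4 * d (k + 1) ^ 2
      - γ (k - 1) * c (k - 1) / 8 * d k ^ 2 := by
  induction k with
  | zero =>
    have h := mul_le_mul_of_nonneg_left (hstep 0 le_rfl) (hpos 0 le_rfl).1.le
    simp only [hP0, hN0, hK0, zero_add] at h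
    simp [hd0]
    linarith
  | succ j ih =>
    have hih := ih (fun t ht => hpos t (by omega)) (fun t ht => hθ t (by omega))
      (fun t ht => hτ t (by omega)) (fun t ht => hη t (by omega)) (fun t ht => hc t (by omega))
      (fun t ht => hfar t (by omega)) (fun t ht => hnear t (by omega))
      (fun t ht => hW t (by omega)) (fun t ht => hY t (by omega))
      (fun t ht => hK t (by omega)) (fun t ht => hstep t (by omega))
    rw [sum_range_succ, sum_range_succ _ (j + 1), sum_Ico_succ_top (by omega)]
    obtain ⟨hγ1, hθ1, hτ1⟩ := hpos (j + 1) le_rfl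
    obtain ⟨hγ0, hθ0, hτ0⟩ := hpos j (by omega)
    have h := mul_le_mul_of_nonneg_left (hstep (j + 1) le_rfl) hγ1.le
    have hWj := mul_le_mul_of_nonneg_right (hη j (by omega)) (hW (j + 1) (by omega))
    have hYj := mul_le_mul_of_nonneg_right (hτ j (by omega)) (hY (j + 1) (by omega))
    have hPj : γ (j + 1) * (θ (j + 1) * P (j + 1)) = γ j * P (j + 1) := by
      rw [← hθ j (by omega)]; ring
    have hweight : γ (j + 1) * (3 * θ (j + 1) ^ 2 / (4 * τ (j + 1)))
        = 3 * γ j * θ (j + 1) / (4 * τ (j + 1)) := by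
      rw [← hθ j (by omega)]; ring
    have hnear' : θ (j + 1) * Q / τ (j + 1) ≤ c j / 12 := by
      rw [div_le_iff₀ hτ1]; linarith [hnear j (by omega)]
    have hfar' : γ j * (4 * Q * θ (j + 1) / τ (j + 1)) * d j ^ 2
        ≤ γ (j - 1) * c (j - 1) / 12 * d j ^ 2 := by
      rcases j with _ | i
      · simp [hd0]
      · refine mul_le_mul_of_nonneg_right ?_ (sq_nonneg _)
        have h1 := hfar (i + 1) (by omega)
        rw [div_le_iff₀ hθ0] at h1
        have h2 : 4 * Q * θ (i + 1 + 1) / τ (i + 1 + 1) ≤ c i * θ (i + 1) / 12 := by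
          rw [div_le_iff₀ hτ1]
          simp only [add_tsub_cancel_right] at h1
          linarith
        have h3 := mul_le_mul_of_nonneg_left h2 hγ0.le
        have h4 := hθ i (by omega)
        simp only [add_tsub_cancel_right]
        rw [← h4]
        linarith
    have hKj : γ (j + 1) * (3 * θ (j + 1) ^ 2 / (4 * τ (j + 1)) * K (j + 1))
        ≤ γ j * c j / 8 * d (j + 1) ^ 2 + γ (j - 1) * c (j - 1) / 8 * d j ^ 2 := by
      rw [← mul_assoc, hweight]
      have hsq : K (j + 1) ≤ Q * (2 * d (j + 1) ^ 2 + 8 * d j ^ 2) :=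
        (hK j (by omega)).trans (mul_le_mul_of_nonneg_left
          (by nlinarith [sq_nonneg (d (j + 1) - 2 * d j)]) hQ)
      have h1 := mul_le_mul_of_nonneg_left hsq
        (show 0 ≤ 3 * γ j * θ (j + 1) / (4 * τ (j + 1)) by positivity)
      have h2 : 3 * γ j * θ (j + 1) / (4 * τ (j + 1)) * (Q * (2 * d (j + 1) ^ 2 + 8 * d j ^ 2))
          = 3 / 2 * (γ j * d (j + 1) ^ 2 * (θ (j + 1) * Q / τ (j + 1)))
            + 3 / 2 * (γ j * (4 * Q * θ (j + 1) / τ (j + 1)) * d j ^ 2) := by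
        field_simp
        ring
      have h3 := mul_le_mul_of_nonneg_left hnear'
        (show 0 ≤ γ j * d (j + 1) ^ 2 by positivity)
      linarith
    have hNj : γ (j + 1) * (3 * θ (j + 1) ^ 2 / (2 * τ (j + 1)) * N (j + 1))
        = 3 * γ (j + 1) * θ (j + 1) ^ 2 / (2 * τ (j + 1)) * N (j + 1) := by ring
    simp only [add_tsub_cancel_right]
    linarith

/-- A linear term in the step length together with a quadratic term is absorbed by `c / 4`. -/
lemma linear_add_quadratic_le {c a b d : ℝ} (hc : 0 < c) :
    (a + b) * d - c / 2 * d ^ 2 ≤ 2 / c * (a ^ 2 + b ^ 2) - c / 4 * d ^ 2 := by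
  have h : 2 / c * (a ^ 2 + b ^ 2) - c / 4 * d ^ 2 - ((a + b) * d - c / 2 * d ^ 2)
      = 2 / c * ((a - c * d / 4) ^ 2 + (b - c * d / 4) ^ 2) := by
    field_simp
    ring
  have : 0 ≤ 2 / c * ((a - c * d / 4) ^ 2 + (b - c * d / 4) ^ 2) := by positivity
  linarith

section Lagrangian

variable {E ι : Type*} [NormedAddCommGroup E] [InnerProductSpace ℝ E] [CompleteSpace E] [Fintype ι]

/-- The gap of the Lagrangian between `(p, μ)` and `(z, ν)` in terms of the linearisations of the
objective and of the constraints at `a`. -/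
lemma lagrangian_gap_le {f : E → ℝ} {g : ι → E → ℝ} {L₀ : ℝ} {L : ι → ℝ}
    (hfc : ConvexOn ℝ Set.univ f) (hf : Differentiable ℝ f)
    (hfL : ∀ a b, ‖gradient f a - gradient f b‖ ≤ L₀ * ‖a - b‖)
    (hgc : ∀ i, ConvexOn ℝ Set.univ (g i)) (hg : ∀ i, Differentiable ℝ (g i))
    (hgL : ∀ i a b, ‖gradient (g i) a - gradient (g i) b‖ ≤ L i * ‖a - b‖)
    {μ ν : ι → ℝ} (hμ : ∀ i, 0 ≤ μ i) (hν : ∀ i, 0 ≤ ν i) (a p z : E) :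
    f p + ∑ i, μ i * g i p - (f z + ∑ i, ν i * g i z) ≤
      ⟪gradient f a + ∑ i, ν i • gradient (g i) a, p - z⟫
      - (∑ i, (g i a + ⟪gradient (g i) a, p - a⟫) * (ν i - μ i))
      + (L₀ + √(∑ i, L i ^ 2) * √(∑ i, μ i ^ 2)) / 2 * ‖p - a‖ ^ 2 := by
  have hsplit : ∀ v : E, ⟪v, p - z⟫ = ⟪v, p - a⟫ - ⟪v, z - a⟫ := fun v => by
    rw [← inner_sub_right, sub_sub_sub_cancel_right]
  have h0 : f p - f z ≤ ⟪gradient f a, p - z⟫ + L₀ / 2 * ‖p - a‖ ^ 2 := by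
    rw [hsplit]
    linarith [hf.le_add_inner_gradient_add_sq hfL a p, hfc.add_inner_gradient_le hf a z]
  have hCS : ∑ i, L i * μ i ≤ √(∑ i, L i ^ 2) * √(∑ i, μ i ^ 2) :=
    sum_mul_le_sqrt_mul_sqrt _ _ _
  have hsum : (∑ i, μ i * g i p) - ∑ i, ν i * g i z ≤
      (∑ i, ν i * ⟪gradient (g i) a, p - z⟫)
      - (∑ i, (g i a + ⟪gradient (g i) a, p - a⟫) * (ν i - μ i))
      + (∑ i, L i * μ i) * (‖p - a‖ ^ 2 / 2) := by
    rw [sum_mul, ← sum_sub_distrib, ← sum_sub_distrib, ← sum_add_distrib]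
    refine sum_le_sum fun i _ => ?_
    rw [hsplit]
    have h1 := mul_le_mul_of_nonneg_left
      ((hg i).le_add_inner_gradient_add_sq (hgL i) a p) (hμ i)
    have h2 := mul_le_mul_of_nonneg_left ((hgc i).add_inner_gradient_le (hg i) a z) (hν i)
    linarith
  have h3 := mul_le_mul_of_nonneg_right hCS (show 0 ≤ ‖p - a‖ ^ 2 / 2 by positivity)
  simp only [inner_add_left, sum_inner, real_inner_smul_left]
  linarith

end Lagrangian

/-- the multi-step telescoped inequality for the constraint
extrapolation method (Lemma on `Q_ν`).  Negative indices are handled by the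
conventions `x_{−1} = x_0`, `ℓ_F(x_{−1}) = ℓ_F(x_0)` and `η_s = η_0` for `s < 0`,
which are implemented by truncated subtraction on `ℕ`.  The Euclidean inner product
on `ℝ^m` is written out as `∑ i, a i * b i` and the squared Euclidean norm as
`∑ i, (a i)²`. -/
theorem statement18
    {n m : ℕ}
    (X : Set (EuclideanSpace ℝ (Fin n))) (hX : Convex ℝ X) (D_X : ℝ)
    (hD : ∀ x' ∈ X, ∀ x'' ∈ X, ‖x' - x''‖ ≤ D_X)
    (w : EuclideanSpace ℝ (Fin n) → ℝ) (hw : Differentiable ℝ w)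
    (W : EuclideanSpace ℝ (Fin n) → EuclideanSpace ℝ (Fin n) → ℝ)
    (hWdef : ∀ b a, W b a = w b - w a - ⟪gradient w a, b - a⟫)
    (hWlb : ∀ b a, W b a ≥ 1 / 2 * ‖b - a‖ ^ 2)
    (φ0 : EuclideanSpace ℝ (Fin n) → ℝ) (L0 : ℝ)
    (hconv0 : ConvexOn ℝ Set.univ φ0) (hdiff0 : Differentiable ℝ φ0)
    (hgl0 : ∀ a b, ‖gradient φ0 a - gradient φ0 b‖ ≤ L0 * ‖a - b‖)
    (φ : Fin m → EuclideanSpace ℝ (Fin n) → ℝ) (L M : Fin m → ℝ)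
    (hconv : ∀ i, ConvexOn ℝ Set.univ (φ i)) (hdiff : ∀ i, Differentiable ℝ (φ i))
    (hgl : ∀ i a b, ‖gradient (φ i) a - gradient (φ i) b‖ ≤ L i * ‖a - b‖)
    (hgb : ∀ i a, ‖gradient (φ i) a‖ ≤ M i)
    (Mf Lf : ℝ)
    (hMf : Mf = Real.sqrt (∑ i, (M i) ^ 2)) (hLf : Lf = Real.sqrt (∑ i, (L i) ^ 2))
    (T : ℕ) (hT : 1 ≤ T)
    (γ θ τ η : ℕ → ℝ)
    (hpos : ∀ t ≤ T - 1, 0 < γ t ∧ 0 < θ t ∧ 0 < τ t ∧ 0 < η t)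
    (hηL : ∀ t ≤ T - 1, L0 + Lf < η t)
    (hc1 : ∀ t, 1 ≤ t → t ≤ T - 1 → γ t * θ t = γ (t - 1))
    (hc2 : ∀ t, 1 ≤ t → t ≤ T - 1 → γ t * τ t ≤ γ (t - 1) * τ (t - 1))
    (hc3 : ∀ t, 1 ≤ t → t ≤ T - 1 → γ t * η t ≤ γ (t - 1) * η (t - 1))
    (hc4 : ∀ t, 1 ≤ t → t ≤ T - 1 →
      (2 * Mf) ^ 2 * θ t / θ (t - 1) ≤ τ t * (η (t - 2) - L0 - Lf) / 12)
    (hc5 : ∀ t, 1 ≤ t → t ≤ T - 1 →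
      θ t * Mf ^ 2 ≤ τ t * (η (t - 1) - L0 - Lf) / 12)
    (hc6 : (2 * Mf) ^ 2 / θ (T - 1) ≤ τ (T - 1) * (η (T - 2) - L0 - Lf) / 12)
    (hc7 : Mf ^ 2 ≤ τ (T - 1) * (η (T - 1) - L0 - Lf) / 12)
    (x : ℕ → EuclideanSpace ℝ (Fin n)) (hxX : ∀ t ≤ T, x t ∈ X)
    (y : ℕ → Fin m → ℝ) (hy0 : ∀ i, 0 ≤ y 0 i)
    (δG : ℕ → EuclideanSpace ℝ (Fin n)) (δF : ℕ → Fin m → ℝ)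
    (ℓφ ℓF q qbar s : ℕ → Fin m → ℝ)
    (hℓφ : ∀ t i, ℓφ t i = φ i (x (t - 1)) + ⟪gradient (φ i) (x (t - 1)), x t - x (t - 1)⟫)
    (hℓF : ∀ t i, ℓF t i = ℓφ t i + δF t i)
    (hq : ∀ t i, q t i = ℓF t i - ℓF (t - 1) i)
    (hqbar : ∀ t i, qbar t i = ℓφ t i - ℓφ (t - 1) i)
    (hs : ∀ t i, s t i = (1 + θ t) * ℓF t i - θ t * ℓF (t - 1) i)
    (hymin : ∀ t ≤ T - 1, (∀ i, 0 ≤ y (t + 1) i) ∧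
      ∀ y' : Fin m → ℝ, (∀ i, 0 ≤ y' i) →
        (∑ i, (-(s t i)) * y (t + 1) i) + τ t / 2 * ∑ i, (y (t + 1) i - y t i) ^ 2
          ≤ (∑ i, (-(s t i)) * y' i) + τ t / 2 * ∑ i, (y' i - y t i) ^ 2)
    (V : ℕ → EuclideanSpace ℝ (Fin n))
    (hV : ∀ t, V t = gradient φ0 (x t) + (∑ i, y (t + 1) i • gradient (φ i) (x t)) + δG t)
    (hxmin : ∀ t ≤ T - 1, ∀ x' ∈ X,
      ⟪V t, x (t + 1)⟫ + η t * W (x (t + 1)) (x t) ≤ ⟪V t, x'⟫ + η t * W x' (x t))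
    (Lν : EuclideanSpace ℝ (Fin n) → (Fin m → ℝ) → ℝ)
    (hLν : ∀ x' y', Lν x' y' = φ0 x' + ∑ i, y' i * φ i x') :
    ∀ xs ∈ X, ∀ ys : Fin m → ℝ, (∀ i, 0 ≤ ys i) →
      (∑ t ∈ Finset.range T, γ t * (Lν (x (t + 1)) ys - Lν xs (y (t + 1))))
        + ∑ t ∈ Finset.range T,
            γ t * (⟪δG t, x t - xs⟫ - ∑ i, δF (t + 1) i * (y (t + 1) i - ys i))
      ≤ γ 0 * η 0 * W xs (x 0) - γ (T - 1) * η (T - 1) * W xs (x T)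
        + γ 0 * τ 0 / 2 * (∑ i, (ys i - y 0 i) ^ 2)
        - γ (T - 1) * τ (T - 1) / 12 * (∑ i, (ys i - y T i) ^ 2)
        + (∑ t ∈ Finset.range T, 2 * γ t / (η t - L0 - Lf) *
            (‖δG t‖ ^ 2
              + (Lf * D_X / 2 * max (Real.sqrt (∑ i, (ys i) ^ 2) - 1) 0) ^ 2))
        + (∑ t ∈ Finset.Ico 1 T,
            3 * γ t * (θ t) ^ 2 / (2 * τ t) * (∑ i, (q t i - qbar t i) ^ 2))
        + 3 * γ (T - 1) / (2 * τ (T - 1)) * (∑ i, (q T i - qbar T i) ^ 2) := by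
  intro xs hxs ys hys
  obtain ⟨k, rfl⟩ : ∃ k, T = k + 1 := ⟨T - 1, by omega⟩
  simp only [add_tsub_cancel_right] at *
  have hk2 : ∀ t, t + 1 - 2 = t - 1 := fun t => by omega
  rw [hk2] at hc6
  have hc : ∀ t ≤ k, 0 < η t - L0 - Lf := fun t ht => by linarith [hηL t ht]
  have hLf0 : 0 ≤ Lf := hLf ▸ Real.sqrt_nonneg _
  have hMf2 : ∑ i, (M i) ^ 2 = Mf ^ 2 := by
    rw [hMf, Real.sq_sqrt (sum_nonneg fun i _ => sq_nonneg _)]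
  set B : ℝ := Lf * D_X / 2 * max (√(∑ i, ys i ^ 2) - 1) 0 with hB
  set A : ℕ → ℝ := fun t => (Lν (x (t + 1)) ys - Lν xs (y (t + 1)))
    + (⟪δG t, x t - xs⟫ - ∑ i, δF (t + 1) i * (y (t + 1) i - ys i)) with hA
  set Y : ℕ → ℝ := fun t => ∑ i, (ys i - y t i) ^ 2
  set P : ℕ → ℝ := fun t => ∑ i, q t i * (y t i - ys i) with hP
  set d : ℕ → ℝ := fun t => ‖x t - x (t - 1)‖ with hd
  set N : ℕ → ℝ := fun t => ∑ i, (q t i - qbar t i) ^ 2 with hN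
  set K : ℕ → ℝ := fun t => ∑ i, (qbar t i) ^ 2 with hK
  have hq0 : ∀ i, q 0 i = 0 := fun i => by simp [hq]
  have hqbar0 : ∀ i, qbar 0 i = 0 := fun i => by simp [hqbar]
  have hKbound : ∀ t, K (t + 1) ≤ Mf ^ 2 * (d (t + 1) + 2 * d t) ^ 2 := by
    intro t
    rw [← hMf2, sum_mul]
    refine sum_le_sum fun i _ => ?_
    rw [← mul_pow, ← sq_abs]
    refine pow_le_pow_left₀ (abs_nonneg _) ?_ 2
    rw [hqbar, hℓφ, hℓφ]
    exact (hconv i).abs_linearization_sub_le (hdiff i) (hgb i) _ _ _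
  have hdrift : ∀ t ≤ k, A t ≤ η t * (W xs (x t) - W xs (x (t + 1)))
      + τ t / 2 * (Y t - Y (t + 1)) - τ t / 2 * ∑ i, (y (t + 1) i - y t i) ^ 2
      - (η t - L0 - Lf) / 4 * d (t + 1) ^ 2
      + 2 / (η t - L0 - Lf) * (‖δG t‖ ^ 2 + B ^ 2)
      + (θ t * ∑ i, q t i * (y (t + 1) i - ys i)) - P (t + 1) := by
    intro t ht
    have hgap := lagrangian_gap_le hconv0 hdiff0 hgl0 hconv hdiff hgl hys (hymin t ht).1
      (x t) (x (t + 1)) xs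
    have hx := bregman_prox_inequality hX hw hWdef (hxX (t + 1) (by omega)) (hxmin t ht) hxs
    have hy := orthant_prox_inequality (hymin t ht).1 (hymin t ht).2 hys
    have hWt := mul_le_mul_of_nonneg_left (hWlb (x (t + 1)) (x t)) (hpos t ht).2.2.2.le
    rw [hV, inner_add_left] at hx
    rw [← hLf] at hgap
    have hδ : ⟪δG t, x t - xs⟫ - ⟪δG t, x (t + 1) - xs⟫ ≤ ‖δG t‖ * d (t + 1) := by
      rw [← inner_sub_right, sub_sub_sub_cancel_right]
      refine (real_inner_le_norm _ _).trans_eq ?_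
      rw [norm_sub_rev]
      rfl
    have hsum : ∑ i, s t i * (y (t + 1) i - ys i)
        = (∑ i, (φ i (x t) + ⟪gradient (φ i) (x t), x (t + 1) - x t⟫) * (y (t + 1) i - ys i))
          + (∑ i, δF (t + 1) i * (y (t + 1) i - ys i))
          + (θ t * ∑ i, q t i * (y (t + 1) i - ys i)) - P (t + 1) := by
      rw [hP, mul_sum, ← sum_add_distrib, ← sum_add_distrib, ← sum_sub_distrib]
      refine sum_congr rfl fun i _ => ?_
      simp only [hs, hq, hℓF (t + 1), hℓφ (t + 1), add_tsub_cancel_right]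
      ring
    have hdD : d (t + 1) ≤ D_X := hD _ (hxX (t + 1) (by omega)) _ (hxX t (by omega))
    have hd0 : 0 ≤ d (t + 1) := norm_nonneg _
    have hys1 : Lf * √(∑ i, ys i ^ 2) / 2 * d (t + 1) ^ 2
        ≤ Lf / 2 * d (t + 1) ^ 2 + B * d (t + 1) := by
      set r := √(∑ i, ys i ^ 2)
      have h1 : r ≤ 1 + max (r - 1) 0 := by linarith [le_max_left (r - 1) 0]
      have h2 := mul_le_mul_of_nonneg_left h1 (show 0 ≤ Lf / 2 * d (t + 1) ^ 2 by positivity)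
      have h3 := mul_le_mul_of_nonneg_left hdD
        (show 0 ≤ Lf / 2 * max (r - 1) 0 * d (t + 1) by positivity)
      rw [hB]
      linarith
    have habs := linear_add_quadratic_le (a := ‖δG t‖) (b := B) (d := d (t + 1)) (hc t ht)
    have hdt : ‖x (t + 1) - x t‖ = d (t + 1) := rfl
    rw [hdt] at hgap hWt
    simp only [hA, hLν]
    linarith
  have hstep : ∀ t ≤ k, A t ≤ η t * (W xs (x t) - W xs (x (t + 1)))
      + τ t / 2 * (Y t - Y (t + 1)) + (θ t * P t - P (t + 1))
      - (η t - L0 - Lf) / 4 * d (t + 1) ^ 2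
      + 2 / (η t - L0 - Lf) * (‖δG t‖ ^ 2 + B ^ 2)
      + 3 * θ t ^ 2 / (2 * τ t) * N t + 3 * θ t ^ 2 / (4 * τ t) * K t := by
    intro t ht
    obtain ⟨-, hθt, hτt, -⟩ := hpos t ht
    have hyoung := mul_le_mul_of_nonneg_left ((le_abs_self _).trans
      (abs_sum_mul_le_young (q t) (qbar t) (fun i => y (t + 1) i - y t i)
        (show 0 < τ t / (6 * θ t) by positivity) (show 0 < τ t / (3 * θ t) by positivity))) hθt.le
    have hcoef : θ t * (N t / (4 * (τ t / (6 * θ t))) + K t / (4 * (τ t / (3 * θ t)))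
        + (τ t / (6 * θ t) + τ t / (3 * θ t)) * ∑ i, (y (t + 1) i - y t i) ^ 2)
        = 3 * θ t ^ 2 / (2 * τ t) * N t + 3 * θ t ^ 2 / (4 * τ t) * K t
          + τ t / 2 * ∑ i, (y (t + 1) i - y t i) ^ 2 := by
      field_simp
      ring
    have hsplit : ∑ i, q t i * (y (t + 1) i - ys i)
        = P t + ∑ i, q t i * (y (t + 1) i - y t i) := by
      rw [hP, ← sum_add_distrib]
      exact sum_congr rfl fun i _ => by ring
    have h := hdrift t ht
    rw [hsplit] at h
    linarith
  have htele := sum_range_succ_le_of_step_bounds (k := k) (γ := γ) (Q := Mf ^ 2)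
    (W := fun t => W xs (x t)) (c := fun t => η t - L0 - Lf)
    (fun t ht => ⟨(hpos t ht).1, (hpos t ht).2.1, (hpos t ht).2.2.1⟩)
    (fun t ht => hc1 (t + 1) (by omega) (by omega))
    (fun t ht => hc2 (t + 1) (by omega) (by omega))
    (fun t ht => hc3 (t + 1) (by omega) (by omega)) hc
    (fun t ht => by
      have h := hc4 (t + 1) (by omega) (by omega)
      rw [mul_pow, hk2] at h
      norm_num at h ⊢
      exact h)
    (fun t ht => hc5 (t + 1) (by omega) (by omega))
    (fun t _ => (by positivity : (0 : ℝ) ≤ 1 / 2 * ‖xs - x t‖ ^ 2).trans (hWlb xs (x t)))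
    (fun t _ => sum_nonneg fun i _ => sq_nonneg _)
    (by simp [hP, hq0]) (by simp [hN, hq0, hqbar0]) (by simp [hd]) (sq_nonneg _)
    (by simp [hK, hqbar0]) (fun t _ => hKbound t) hstep
  obtain ⟨hγk, hθk, hτk, -⟩ := hpos k le_rfl
  have hlast := mul_le_mul_of_nonneg_left ((neg_le_abs _).trans
    (abs_sum_mul_le_young (q (k + 1)) (qbar (k + 1)) (fun i => y (k + 1) i - ys i)
      (show 0 < τ k / 6 by positivity) (show 0 < τ k / 4 by positivity))) hγk.le
  have hYswap : ∑ i, (y (k + 1) i - ys i) ^ 2 = Y (k + 1) :=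
    sum_congr rfl fun i _ => by ring
  have hcoef : γ k * (N (k + 1) / (4 * (τ k / 6)) + K (k + 1) / (4 * (τ k / 4))
      + (τ k / 6 + τ k / 4) * Y (k + 1))
      = 3 * γ k / (2 * τ k) * N (k + 1) + γ k / τ k * K (k + 1)
        + 5 * (γ k * τ k) / 12 * Y (k + 1) := by
    field_simp
    ring
  rw [hYswap] at hlast
  have hKlast : γ k / τ k * K (k + 1) ≤ γ k * (η k - L0 - Lf) / 4 * d (k + 1) ^ 2
      + γ (k - 1) * (η (k - 1) - L0 - Lf) / 8 * d k ^ 2 := by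
    have hsq : K (k + 1) ≤ Mf ^ 2 * (3 * d (k + 1) ^ 2 + 6 * d k ^ 2) :=
      (hKbound k).trans (mul_le_mul_of_nonneg_left
        (by nlinarith [sq_nonneg (d (k + 1) - d k)]) (sq_nonneg _))
    have h1 := mul_le_mul_of_nonneg_left hsq (show 0 ≤ γ k / τ k by positivity)
    have hnear : γ k / τ k * Mf ^ 2 ≤ γ k * (η k - L0 - Lf) / 12 := by
      rw [div_mul_eq_mul_div, div_le_iff₀ hτk]
      linarith [mul_le_mul_of_nonneg_left hc7 hγk.le]
    have hfar : γ k / τ k * Mf ^ 2 * d k ^ 2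
        ≤ γ (k - 1) * (η (k - 1) - L0 - Lf) / 48 * d k ^ 2 := by
      rcases k with _ | j
      · simp [hd]
      · refine mul_le_mul_of_nonneg_right ?_ (sq_nonneg _)
        rw [div_le_iff₀ hθk] at hc6
        have h2 := mul_le_mul_of_nonneg_left hc6 hγk.le
        have h3 := hc1 (j + 1) (by omega) le_rfl
        simp only [add_tsub_cancel_right] at h2 h3 ⊢
        rw [div_mul_eq_mul_div, div_le_iff₀ hτk, ← h3]
        linarith
    have h3 := mul_le_mul_of_nonneg_right hnear (sq_nonneg (d (k + 1)))
    linarith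
  have hE : ∀ t, γ t * (2 / (η t - L0 - Lf) * (‖δG t‖ ^ 2 + B ^ 2))
      = 2 * γ t / (η t - L0 - Lf) * (‖δG t‖ ^ 2 + B ^ 2) := fun t => by ring
  simp only [hE] at htele
  rw [← sum_add_distrib]
  simp only [← mul_add]
  linarith
end
end
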